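/- arXiv:2401.04121 — 7 statements merged into one kernel-verified Lean document; each statement's English description precedes it below -/
import Mathlib

section
/- Let ω, q_x, q_y be real numbers and define φ(n,m,t) = exp(i(ω t − q_x n − q_y m)) for n, m ∈ ℤ and t ∈ ℝ. Then φ satisfies the undamped lattice wave equation ∂²φ/∂t²(n,m,t) = (Dφ(·,·,t))(n,m) for all n, m ∈ ℤ and all t ∈ ℝ if and only if ω² = 4 − cos q_x − cos q_y − 2 cos q_x cos q_y. -/
open Complex

/-- The lattice operator `D` acting on functions `φ : ℤ × ℤ → ℂ`. -/
noncomputable def latticeD (φ : ℤ × ℤ → ℂ) : ℤ × ℤ → ℂ := fun p =>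
  (φ (p.1 + 1, p.2 + 1) + φ (p.1 - 1, p.2 - 1) + φ (p.1 + 1, p.2 - 1) + φ (p.1 - 1, p.2 + 1)
    + φ (p.1 + 1, p.2) + φ (p.1 - 1, p.2) + φ (p.1, p.2 + 1) + φ (p.1, p.2 - 1)
    - 8 * φ p) / 2

/-- The second derivative of a complex exponential oscillation of frequency `ω`. -/
theorem iteratedDeriv_two_exp_oscillation (ω : ℝ) (a b : ℂ) (t : ℝ) :
    iteratedDeriv 2 (fun s : ℝ => exp (I * (ω * s - a - b))) t =
      -(ω : ℂ) ^ 2 * exp (I * (ω * t - a - b)) := by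
  have hderiv (s : ℝ) : HasDerivAt (fun s : ℝ => exp (I * (ω * s - a - b)))
      (I * ω * exp (I * (ω * s - a - b))) s := by
    have hphase : HasDerivAt (fun s : ℝ => I * ((ω : ℂ) * s - a - b)) (I * (ω * 1)) s :=
      ((((hasDerivAt_id s).ofReal_comp.const_mul (ω : ℂ)).sub_const a).sub_const b).const_mul I
    convert hphase.cexp using 1
    ring
  rw [iteratedDeriv_succ, iteratedDeriv_one, funext fun s => (hderiv s).deriv,
    ((hderiv t).const_mul (I * ω)).deriv]
  linear_combination (ω : ℂ) ^ 2 * exp (I * (ω * t - a - b)) * I_sq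

/-- Plane waves are eigenfunctions of the lattice operator. -/
theorem latticeD_planeWave (c x y : ℂ) (n m : ℤ) :
    latticeD (fun p => exp (I * (c - x * p.1 - y * p.2))) (n, m) =
      (cos x + cos y + 2 * cos x * cos y - 4) * exp (I * (c - x * n - y * m)) := by
  have hshift (j k : ℤ) : exp (I * (c - x * (n + j) - y * (m + k))) =
      exp (I * (c - x * n - y * m)) * exp (-x * I) ^ j * exp (-y * I) ^ k := by
    rw [← exp_int_mul, ← exp_int_mul, ← exp_add, ← exp_add]
    ring_nf
  have h₁ := hshift 1 1
  have h₂ := hshift (-1) (-1)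
  have h₃ := hshift 1 (-1)
  have h₄ := hshift (-1) 1
  have h₅ := hshift 1 0
  have h₆ := hshift (-1) 0
  have h₇ := hshift 0 1
  have h₈ := hshift 0 (-1)
  simp only [Int.cast_one, Int.cast_neg, Int.cast_zero, zpow_one, zpow_neg, zpow_zero, add_zero,
    mul_one, ← sub_eq_add_neg, ← exp_neg, neg_mul, neg_neg] at h₁ h₂ h₃ h₄ h₅ h₆ h₇ h₈
  simp only [latticeD, Int.cast_add, Int.cast_sub, Int.cast_one, h₁, h₂, h₃, h₄, h₅, h₆, h₇, h₈,
    cos, neg_mul]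
  ring

/-- The plane wave `φ(n,m,t) = exp(i(ω t − q_x n − q_y m))` satisfies the undamped lattice wave
equation `∂²φ/∂t² = Dφ` if and only if the dispersion relation
`ω² = 4 − cos q_x − cos q_y − 2 cos q_x cos q_y` holds. -/
theorem planeWave_solves_lattice_iff_dispersion (ω qx qy : ℝ)
    (φ : ℤ → ℤ → ℝ → ℂ)
    (hφ : ∀ (n m : ℤ) (t : ℝ),
      φ n m t = Complex.exp (Complex.I * (ω * t - qx * n - qy * m))) :
    (∀ (n m : ℤ) (t : ℝ),
        iteratedDeriv 2 (fun s => φ n m s) t = latticeD (fun p => φ p.1 p.2 t) (n, m)) ↔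
      ω ^ 2 = 4 - Real.cos qx - Real.cos qy - 2 * Real.cos qx * Real.cos qy := by
  obtain rfl : φ = fun (n m : ℤ) (t : ℝ) => exp (I * (ω * t - qx * n - qy * m)) := by
    funext n m t
    exact hφ n m t
  have hpoint (n m : ℤ) (t : ℝ) :
      iteratedDeriv 2 (fun s : ℝ => exp (I * (ω * s - qx * n - qy * m))) t =
          latticeD (fun p => exp (I * (ω * t - qx * p.1 - qy * p.2))) (n, m) ↔
        ω ^ 2 = 4 - Real.cos qx - Real.cos qy - 2 * Real.cos qx * Real.cos qy := by
    rw [iteratedDeriv_two_exp_oscillation, latticeD_planeWave, mul_left_inj' (exp_ne_zero _)]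
    norm_cast
    constructor <;> intro h <;> linarith
  exact ⟨fun h => (hpoint 0 0 0).1 (h 0 0 0), fun h n m t => (hpoint n m t).2 h⟩
end

section
/- Define Ω(q_x, q_y) = √(4 − cos q_x − cos q_y − 2 cos q_x cos q_y) for (q_x, q_y) ∈ ℝ². Then Ω(q_x, q_y)/√(q_x² + q_y²) tends to √(3/2) as (q_x, q_y) → (0,0) with (q_x, q_y) ≠ (0,0). In particular, the velocity of infinitely long longitudinal waves in the lattice equals c₁ = √(3/2) and is the same in all propagation directions. -/
open Real Filter Topology

/-- The dispersion relation of the undamped 2D square lattice. -/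
noncomputable def Ω (q : ℝ × ℝ) : ℝ :=
  Real.sqrt (4 - Real.cos q.1 - Real.cos q.2 - 2 * Real.cos q.1 * Real.cos q.2)

/-- Quadratic Taylor estimate for the lattice symbol at the origin. -/
theorem abs_symbol_sub_le {x y : ℝ} (hx : |x| ≤ 1) (hy : |y| ≤ 1) :
    |(4 - Real.cos x - Real.cos y - 2 * Real.cos x * Real.cos y) - 3 / 2 * (x ^ 2 + y ^ 2)|
      ≤ (x ^ 2 + y ^ 2) ^ 2 := by
  have hcx := (abs_le.1 (Real.cos_bound hx)).2
  have hcy := (abs_le.1 (Real.cos_bound hy)).2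
  rw [Even.pow_abs (by decide)] at hcx hcy
  have hlx := Real.one_sub_sq_div_two_le_cos (x := x)
  have hly := Real.one_sub_sq_div_two_le_cos (x := y)
  have hux := Real.cos_le_one x
  have huy := Real.cos_le_one y
  have h0 : 0 ≤ (1 - Real.cos x) * (1 - Real.cos y) :=
    mul_nonneg (by linarith) (by linarith)
  have h1 : (1 - Real.cos x) * (1 - Real.cos y) ≤ x ^ 2 / 2 * (y ^ 2 / 2) :=
    mul_le_mul (by linarith) (by linarith) (by linarith) (by positivity)
  have hxy : 0 ≤ x ^ 2 * y ^ 2 := by positivity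
  have hx4 : 0 ≤ x ^ 4 := by positivity
  have hy4 : 0 ≤ y ^ 4 := by positivity
  rw [abs_le]
  constructor <;> nlinarith

/-- The velocity of infinitely long longitudinal waves in the lattice equals `√(3/2)`
in every propagation direction: `Ω(q)/‖q‖ → √(3/2)` as `q → 0`, `q ≠ 0`. -/
theorem longwave_velocity :
    Tendsto (fun q : ℝ × ℝ => Ω q / Real.sqrt (q.1 ^ 2 + q.2 ^ 2))
      (𝓝[≠] ((0, 0) : ℝ × ℝ)) (𝓝 (Real.sqrt (3 / 2))) := by
  have key : Tendsto (fun q : ℝ × ℝ =>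
      (4 - Real.cos q.1 - Real.cos q.2 - 2 * Real.cos q.1 * Real.cos q.2) /
        (q.1 ^ 2 + q.2 ^ 2)) (𝓝[≠] ((0, 0) : ℝ × ℝ)) (𝓝 (3 / 2)) := by
    rw [tendsto_iff_norm_sub_tendsto_zero]
    have hlim : Tendsto (fun q : ℝ × ℝ => q.1 ^ 2 + q.2 ^ 2)
        (𝓝[≠] ((0, 0) : ℝ × ℝ)) (𝓝 0) := by
      have hc : Continuous (fun q : ℝ × ℝ => q.1 ^ 2 + q.2 ^ 2) := by fun_prop
      simpa using (hc.tendsto (0, 0)).mono_left nhdsWithin_le_nhds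
    refine squeeze_zero' (Eventually.of_forall fun _ => norm_nonneg _) ?_ hlim
    filter_upwards [self_mem_nhdsWithin,
      mem_nhdsWithin_of_mem_nhds (Metric.closedBall_mem_nhds ((0, 0) : ℝ × ℝ) one_pos)]
      with q hq hball
    have hs : 0 < q.1 ^ 2 + q.2 ^ 2 := by
      refine lt_of_le_of_ne (by positivity) fun h => hq ?_
      have h1 : q.1 = 0 := by nlinarith [sq_nonneg q.1, sq_nonneg q.2]
      have h2 : q.2 = 0 := by nlinarith [sq_nonneg q.1, sq_nonneg q.2]
      exact Prod.ext h1 h2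
    have hle : |q.1| ≤ 1 ∧ |q.2| ≤ 1 := by
      simpa [Prod.dist_eq] using hball
    rw [Real.norm_eq_abs, div_sub' hs.ne', abs_div, abs_of_pos hs, div_le_iff₀ hs,
      mul_comm (q.1 ^ 2 + q.2 ^ 2) (3 / 2), ← sq]
    exact abs_symbol_sub_le hle.1 hle.2
  refine ((Real.continuous_sqrt.tendsto _).comp key).congr fun q => ?_
  exact Real.sqrt_div' _ (by positivity)
end

section
/- For every real κ ≠ 0, with η = κ²/8, one has ∫_0^∞ e^{−z²} z^{−1/2} sin(π/4 − zκ) dz = (π/4) · e^{−η} · |κ|^{1/2} · ( I_{−1/4}(η) − sgn(κ) · I_{1/4}(η) ), where sgn(κ) is the sign of κ. -/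
open Real MeasureTheory

/-- The modified Bessel function of the first kind, `I_ν(x) = ∑_{k≥0} (x/2)^{2k+ν}/(k!·Γ(k+ν+1))`. -/
noncomputable def besselI (ν x : ℝ) : ℝ :=
  ∑' k : ℕ, (x / 2) ^ (2 * (k : ℝ) + ν) / ((Nat.factorial k : ℝ) * Real.Gamma ((k : ℝ) + ν + 1))

open scoped PowerSeries

/-- The coefficients of the entire function `(x / 2) ^ (-ν) * I_ν(x)` in powers of `x ^ 2`. -/
noncomputable def besselCoeff (ν : ℝ) (k : ℕ) : ℝ :=
  1 / ((Nat.factorial k : ℝ) * Real.Gamma ((k : ℝ) + ν + 1) * 4 ^ k)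

/-- The power series of `(x / 2) ^ (-ν) * I_ν(x)`. -/
noncomputable def besselSeries (ν : ℝ) : PowerSeries ℝ :=
  PowerSeries.mk fun n => if Even n then besselCoeff ν (n / 2) else 0

theorem besselCoeff_succ {ν : ℝ} (hν : -1 < ν) (k : ℕ) :
    4 * ((k : ℝ) + 1) * (k + ν + 1) * besselCoeff ν (k + 1) = besselCoeff ν k := by
  have h0 : (0 : ℝ) < k + ν + 1 := by have := k.cast_nonneg (α := ℝ); linarith
  have hG := Real.Gamma_pos_of_pos h0
  have hk : ((k + 1 : ℕ) : ℝ) + ν + 1 = (k + ν + 1) + 1 := by push_cast; ring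
  rw [besselCoeff, besselCoeff, hk, Real.Gamma_add_one h0.ne', Nat.factorial_succ, pow_succ]
  have := Nat.factorial_pos k
  push_cast
  field_simp

theorem besselCoeff_pos {ν : ℝ} (hν : -1 < ν) (k : ℕ) : 0 < besselCoeff ν k := by
  have h0 : (0 : ℝ) < k + ν + 1 := by have := k.cast_nonneg (α := ℝ); linarith
  have hG := Real.Gamma_pos_of_pos h0
  unfold besselCoeff
  positivity

theorem besselCoeff_le {ν : ℝ} (hν : -(3 / 4) ≤ ν) (k : ℕ) :
    besselCoeff ν k ≤ besselCoeff ν 0 / (Nat.factorial k : ℝ) := by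
  have hν' : -1 < ν := by linarith
  induction k with
  | zero => simp
  | succ k ih =>
    have hrec := besselCoeff_succ hν' k
    have hpos := besselCoeff_pos hν' (k + 1)
    have hk := k.cast_nonneg (α := ℝ)
    have hle : ((k : ℝ) + 1) * besselCoeff ν (k + 1) ≤ besselCoeff ν k := by
      rw [← hrec]
      have : (0 : ℝ) ≤ (k + 1) * besselCoeff ν (k + 1) * (4 * (k + ν + 1) - 1) := by
        apply mul_nonneg (by positivity); linarith
      linarith
    have hf : (0 : ℝ) < Nat.factorial k := by exact_mod_cast Nat.factorial_pos k
    rw [le_div_iff₀ hf] at ih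
    rw [Nat.factorial_succ, le_div_iff₀ (by positivity)]
    push_cast
    nlinarith

theorem summable_besselCoeff {ν : ℝ} (hν : -(3 / 4) ≤ ν) (x : ℝ) :
    Summable fun k : ℕ => besselCoeff ν k * x ^ (2 * k) := by
  refine Summable.of_nonneg_of_le (fun k => ?_) (fun k => ?_)
    ((Real.summable_pow_div_factorial (x ^ 2)).mul_left (besselCoeff ν 0))
  · rw [pow_mul]
    exact mul_nonneg (besselCoeff_pos (by linarith) k).le (by positivity)
  · rw [pow_mul]
    calc besselCoeff ν k * (x ^ 2) ^ k
        ≤ besselCoeff ν 0 / (Nat.factorial k : ℝ) * (x ^ 2) ^ k := by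
          gcongr; exact besselCoeff_le hν k
      _ = _ := by ring

theorem besselI_eq_rpow_mul_tsum (ν : ℝ) {x : ℝ} (hx : 0 < x) :
    besselI ν x = (x / 2) ^ ν * ∑' k : ℕ, besselCoeff ν k * x ^ (2 * k) := by
  rw [besselI, ← tsum_mul_left]
  congr 1
  ext k
  rw [Real.rpow_add (by positivity), besselCoeff]
  have : (x / 2) ^ (2 * (k : ℝ)) = x ^ (2 * k) / 4 ^ k := by
    rw [show (2 * (k : ℝ)) = ((2 * k : ℕ) : ℝ) by push_cast; ring, Real.rpow_natCast, div_pow,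
      pow_mul 2]
    norm_num
  rw [this]
  simp only [div_eq_mul_inv, mul_inv]
  ring

theorem hasSum_besselSeries {ν : ℝ} (hν : -(3 / 4) ≤ ν) (x : ℝ) :
    HasSum (fun n : ℕ => PowerSeries.coeff n (besselSeries ν) * x ^ n)
      (∑' k : ℕ, besselCoeff ν k * x ^ (2 * k)) := by
  rw [← (mul_right_injective₀ (two_ne_zero (α := ℕ))).hasSum_iff]
  · convert! (summable_besselCoeff hν x).hasSum using 1
    ext k
    simp [besselSeries]
  · intro n hn
    have : ¬ Even n := by
      rintro ⟨k, rfl⟩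
      exact hn ⟨k, by simp [two_mul]⟩
    simp [besselSeries, this]

/-- The formal Bessel differential equation after removal of the factor `x ^ ν`. -/
theorem besselSeries_ode {ν : ℝ} (hν : -1 < ν) :
    PowerSeries.X * d⁄dX ℝ (d⁄dX ℝ (besselSeries ν))
      + PowerSeries.C (2 * ν + 1) * d⁄dX ℝ (besselSeries ν)
      = PowerSeries.X * besselSeries ν := by
  ext n
  cases n with
  | zero =>
    simp only [LinearMap.map_add, PowerSeries.coeff_zero_X_mul, PowerSeries.coeff_C_mul,
      PowerSeries.coeff_derivative]
    simp [besselSeries]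
  | succ n =>
    simp only [LinearMap.map_add, PowerSeries.coeff_succ_X_mul, PowerSeries.coeff_C_mul,
      PowerSeries.coeff_derivative]
    rcases Nat.even_or_odd n with ⟨k, rfl⟩ | hn
    · have h1 : Even (k + k + 1 + 1) := ⟨k + 1, by ring⟩
      have h2 : (k + k + 1 + 1) / 2 = k + 1 := by omega
      have h3 : (k + k) / 2 = k := by omega
      simp only [besselSeries, PowerSeries.coeff_mk, h1, h2, h3, if_true, Even.add_self]
      rw [← besselCoeff_succ hν k]
      push_cast
      ring
    · have h0 : ¬ Even n := Nat.not_even_iff_odd.mpr hn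
      have h1 : ¬ Even (n + 1 + 1) := by simpa [Nat.even_add_one] using h0
      simp [besselSeries, h0, h1]

theorem coeff_exp_mul_besselSeries_succ {ν : ℝ} (hν : -1 < ν) (n : ℕ) :
    ((n : ℝ) + 1) * (n + (2 * ν + 1)) *
        PowerSeries.coeff (n + 1) (PowerSeries.exp ℝ * besselSeries ν)
      = (2 * n + (2 * ν + 1)) * PowerSeries.coeff n (PowerSeries.exp ℝ * besselSeries ν) := by
  set Y := PowerSeries.exp ℝ * besselSeries ν with hY
  have h1 : d⁄dX ℝ Y = Y + PowerSeries.exp ℝ * d⁄dX ℝ (besselSeries ν) := by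
    rw [hY, Derivation.leibniz, PowerSeries.derivative_exp]
    simp only [smul_eq_mul]; ring
  have h2 : d⁄dX ℝ (d⁄dX ℝ Y) = Y + 2 * (PowerSeries.exp ℝ * d⁄dX ℝ (besselSeries ν))
      + PowerSeries.exp ℝ * d⁄dX ℝ (d⁄dX ℝ (besselSeries ν)) := by
    rw [h1, map_add, h1, Derivation.leibniz, PowerSeries.derivative_exp]
    simp only [smul_eq_mul]; ring
  have hode : PowerSeries.X * d⁄dX ℝ (d⁄dX ℝ Y) + PowerSeries.C (2 * ν + 1) * d⁄dX ℝ Y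
      = PowerSeries.C 2 * (PowerSeries.X * d⁄dX ℝ Y) + PowerSeries.C (2 * ν + 1) * Y := by
    rw [h2, h1, map_ofNat]
    linear_combination (PowerSeries.exp ℝ) * besselSeries_ode hν
  have hc := congrArg (PowerSeries.coeff n) hode
  cases n with
  | zero =>
    simp only [LinearMap.map_add, PowerSeries.coeff_zero_X_mul, PowerSeries.coeff_C_mul,
      PowerSeries.coeff_derivative] at hc
    push_cast at hc ⊢
    linear_combination hc
  | succ n =>
    simp only [LinearMap.map_add, PowerSeries.coeff_succ_X_mul, PowerSeries.coeff_C_mul,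
      PowerSeries.coeff_derivative] at hc
    push_cast at hc ⊢
    linear_combination hc

/-- The second Kummer transformation: a series satisfying the two-term recurrence of
`₁F₁(ν + 1/2; 2ν + 1; 2z)` is a multiple of `exp z * z ^ (-ν) * I_ν(z)`. -/
theorem hasSum_of_kummer_recurrence {ν : ℝ} (hν : -(1 / 2) < ν) {t : ℕ → ℝ}
    (ht : ∀ n : ℕ, ((n : ℝ) + 1) * (n + (2 * ν + 1)) * t (n + 1)
      = (2 * n + (2 * ν + 1)) * t n) (z : ℝ) :
    Summable (fun n => ‖t n * z ^ n‖) ∧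
    HasSum (fun n => t n * z ^ n) (t 0 * Real.Gamma (ν + 1) *
      (Real.exp z * ∑' k : ℕ, besselCoeff ν k * z ^ (2 * k))) := by
  have hG : 0 < Real.Gamma (ν + 1) := Real.Gamma_pos_of_pos (by linarith)
  have hcoeff : ∀ n, t n = t 0 * Real.Gamma (ν + 1) *
      PowerSeries.coeff n (PowerSeries.exp ℝ * besselSeries ν) := by
    intro n
    induction n with
    | zero =>
      simp only [PowerSeries.coeff_zero_eq_constantCoeff, map_mul, PowerSeries.constantCoeff_exp]
      rw [← PowerSeries.coeff_zero_eq_constantCoeff_apply]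
      simp [besselSeries, besselCoeff]
      field_simp
    | succ n ih =>
      have hn := n.cast_nonneg (α := ℝ)
      have hpos : (0 : ℝ) < ((n : ℝ) + 1) * (n + (2 * ν + 1)) :=
        mul_pos (by linarith) (by linarith)
      apply mul_left_cancel₀ hpos.ne'
      rw [ht, ih]
      linear_combination (-(t 0 * Real.Gamma (ν + 1))) *
        coeff_exp_mul_besselSeries_succ (ν := ν) (by linarith) n
  have hE : Summable fun n : ℕ => ‖z ^ n / (Nat.factorial n : ℝ)‖ :=
    NormedSpace.norm_expSeries_div_summable z
  have hB := hasSum_besselSeries (ν := ν) (by linarith) z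
  have hB' := hB.summable.norm
  have hterm : ∀ n, t n * z ^ n = t 0 * Real.Gamma (ν + 1) *
      ∑ kl ∈ Finset.HasAntidiagonal.antidiagonal n, z ^ kl.1 / (Nat.factorial kl.1 : ℝ) *
        (PowerSeries.coeff kl.2 (besselSeries ν) * z ^ kl.2) := by
    intro n
    rw [hcoeff, PowerSeries.coeff_mul, mul_assoc, Finset.sum_mul]
    congr 1
    refine Finset.sum_congr rfl fun kl hkl => ?_
    rw [← Finset.HasAntidiagonal.mem_antidiagonal.mp hkl, pow_add, PowerSeries.coeff_exp]
    simp only [map_div₀, map_one, map_natCast]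
    ring
  have hsum := summable_norm_sum_mul_antidiagonal_of_summable_norm hE hB'
  have hprod := tsum_mul_tsum_eq_tsum_sum_antidiagonal_of_summable_norm hE hB'
  rw [(NormedSpace.expSeries_div_hasSum_exp z).tsum_eq, hB.tsum_eq, ← Real.exp_eq_exp_ℝ] at hprod
  simp_rw [hterm]
  refine ⟨?_, ?_⟩
  · simp_rw [norm_mul (t 0 * Real.Gamma (ν + 1))]
    exact hsum.mul_left _
  · rw [hprod]
    exact hsum.of_norm.hasSum.mul_left _

theorem integrableOn_exp_neg_sq_mul_rpow {q : ℝ} (hq : -1 < q) :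
    IntegrableOn (fun z : ℝ => Real.exp (-z ^ 2) * z ^ q) (Set.Ioi 0) := by
  have h := integrableOn_rpow_mul_exp_neg_rpow hq (zero_lt_two (α := ℝ))
  refine h.congr_fun (fun z _ => ?_) measurableSet_Ioi
  simp only [Real.rpow_ofNat]
  ring

theorem integral_exp_neg_sq_mul_rpow {q : ℝ} (hq : -1 < q) :
    ∫ z in Set.Ioi (0 : ℝ), Real.exp (-z ^ 2) * z ^ q = Real.Gamma ((q + 1) / 2) / 2 := by
  have h := integral_rpow_mul_exp_neg_rpow (zero_lt_two (α := ℝ)) hq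
  simp only [Real.rpow_ofNat] at h
  simp_rw [mul_comm (Real.exp _)]
  rw [h]
  ring

/-- Termwise integration of an even power series against `exp (-z ^ 2) * z ^ q`. -/
theorem hasSum_integral_exp_neg_sq_mul_rpow {q : ℝ} (hq : -1 < q) {c : ℕ → ℝ} {f : ℝ → ℝ}
    (hf : ∀ z, HasSum (fun n => c n * z ^ (2 * n)) (f z))
    (hc : Summable fun n : ℕ => ‖c n * (Real.Gamma (n + (q + 1) / 2) / 2)‖) :
    HasSum (fun n : ℕ => c n * (Real.Gamma (n + (q + 1) / 2) / 2))
      (∫ z in Set.Ioi (0 : ℝ), Real.exp (-z ^ 2) * z ^ q * f z) := by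
  have hqn (n : ℕ) : -1 < q + (2 * n : ℕ) := by
    have := (2 * n).cast_nonneg (α := ℝ); linarith
  have hterm (n : ℕ) : Set.EqOn
      (fun z : ℝ => c n * (Real.exp (-z ^ 2) * z ^ (q + (2 * n : ℕ))))
      (fun z => Real.exp (-z ^ 2) * z ^ q * (c n * z ^ (2 * n))) (Set.Ioi 0) := by
    intro z hz
    simp only [Real.rpow_add (Set.mem_Ioi.mp hz), Real.rpow_natCast]
    ring
  have hint (n : ℕ) : IntegrableOn
      (fun z : ℝ => Real.exp (-z ^ 2) * z ^ q * (c n * z ^ (2 * n))) (Set.Ioi 0) :=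
    IntegrableOn.congr_fun
      ((integrableOn_exp_neg_sq_mul_rpow (hqn n)).const_mul (c n)) (hterm n) measurableSet_Ioi
  have harg (n : ℕ) : (q + (2 * n : ℕ) + 1) / 2 = n + (q + 1) / 2 := by push_cast; ring
  have hval (n : ℕ) : ∫ z in Set.Ioi (0 : ℝ), Real.exp (-z ^ 2) * z ^ q * (c n * z ^ (2 * n))
      = c n * (Real.Gamma (n + (q + 1) / 2) / 2) := by
    rw [← setIntegral_congr_fun measurableSet_Ioi (hterm n), integral_const_mul,
      integral_exp_neg_sq_mul_rpow (hqn n), harg]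
  have hnorm (n : ℕ) :
      ∫ z in Set.Ioi (0 : ℝ), ‖Real.exp (-z ^ 2) * z ^ q * (c n * z ^ (2 * n))‖
      = ‖c n * (Real.Gamma (n + (q + 1) / 2) / 2)‖ := by
    have hG : 0 < Real.Gamma (n + (q + 1) / 2) := by
      apply Real.Gamma_pos_of_pos
      have := n.cast_nonneg (α := ℝ); linarith
    rw [norm_mul, Real.norm_of_nonneg (half_pos hG).le,
      ← harg, ← integral_exp_neg_sq_mul_rpow (hqn n), ← integral_const_mul]
    refine setIntegral_congr_fun measurableSet_Ioi fun z hz => ?_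
    have hz0 : (0 : ℝ) < z := hz
    simp only [← hterm n hz, norm_mul]
    rw [Real.norm_of_nonneg (Real.exp_pos _).le, Real.norm_of_nonneg (Real.rpow_nonneg hz0.le _)]
  have := hasSum_integral_of_summable_integral_norm hint (by simpa only [hnorm] using hc)
  simp only [hval] at this
  convert! this using 1
  refine setIntegral_congr_fun measurableSet_Ioi fun z _ => ?_
  exact (((hf z).mul_left _).tsum_eq).symm

theorem integral_exp_neg_sq_mul_rpow_mul_cos (κ : ℝ) :
    ∫ z in Set.Ioi (0 : ℝ), Real.exp (-z ^ 2) * z ^ (-(1 : ℝ) / 2) * Real.cos (z * κ) =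
      Real.Gamma (1 / 4) * Real.Gamma (3 / 4) / 2 * (Real.exp (-(κ ^ 2 / 8)) *
        ∑' k : ℕ, besselCoeff (-(1 / 4)) k * (κ ^ 2 / 8) ^ (2 * k)) := by
  set t : ℕ → ℝ := fun n => 8 ^ n * (Real.Gamma (n + 1 / 4) / 2) / (Nat.factorial (2 * n) : ℝ)
  have ht (n : ℕ) : ((n : ℝ) + 1) * (n + (2 * (-(1 / 4)) + 1)) * t (n + 1)
      = (2 * n + (2 * (-(1 / 4)) + 1)) * t n := by
    have hpos : (0 : ℝ) < n + 1 / 4 := by positivity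
    have hf : (0 : ℝ) < Nat.factorial (2 * n) := by exact_mod_cast Nat.factorial_pos _
    simp only [t]
    rw [show ((n + 1 : ℕ) : ℝ) + 1 / 4 = (n + 1 / 4) + 1 by push_cast; ring,
      Real.Gamma_add_one hpos.ne', show 2 * (n + 1) = 2 * n + 1 + 1 by ring,
      Nat.factorial_succ, Nat.factorial_succ, pow_succ]
    push_cast
    field_simp
    ring
  obtain ⟨hs, hsum⟩ := hasSum_of_kummer_recurrence (by norm_num) ht (-(κ ^ 2 / 8))
  have hterm (n : ℕ) : (-1) ^ n * κ ^ (2 * n) / (Nat.factorial (2 * n) : ℝ) *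
      (Real.Gamma (n + (-(1 : ℝ) / 2 + 1) / 2) / 2) = t n * (-(κ ^ 2 / 8)) ^ n := by
    rw [show (-(1 : ℝ) / 2 + 1) / 2 = 1 / 4 by norm_num, neg_pow (κ ^ 2 / 8), div_pow, ← pow_mul]
    simp only [t]
    field_simp
  have key := hasSum_integral_exp_neg_sq_mul_rpow (q := -(1 : ℝ) / 2) (by norm_num)
    (c := fun n => (-1) ^ n * κ ^ (2 * n) / (Nat.factorial (2 * n) : ℝ))
    (f := fun z => Real.cos (z * κ)) (fun z => by
      convert! Real.hasSum_cos (z * κ) using 2 with n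
      rw [mul_pow]; ring) (by simpa only [hterm] using hs)
  simp only [hterm] at key
  rw [key.unique hsum]
  simp only [pow_mul, neg_sq, t]
  generalize (∑' k : ℕ, _ : ℝ) = S
  norm_num
  exact Or.inl (by ring)

theorem integral_exp_neg_sq_mul_rpow_mul_sin (κ : ℝ) :
    ∫ z in Set.Ioi (0 : ℝ), Real.exp (-z ^ 2) * z ^ (-(1 : ℝ) / 2) * Real.sin (z * κ) =
      κ * (Real.Gamma (1 / 4) * Real.Gamma (3 / 4)) / 8 * (Real.exp (-(κ ^ 2 / 8)) *
        ∑' k : ℕ, besselCoeff (1 / 4) k * (κ ^ 2 / 8) ^ (2 * k)) := by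
  set t : ℕ → ℝ :=
    fun n => κ * (8 ^ n * (Real.Gamma (n + 3 / 4) / 2)) / (Nat.factorial (2 * n + 1) : ℝ)
  have ht (n : ℕ) : ((n : ℝ) + 1) * (n + (2 * (1 / 4) + 1)) * t (n + 1)
      = (2 * n + (2 * (1 / 4) + 1)) * t n := by
    have hpos : (0 : ℝ) < n + 3 / 4 := by positivity
    have hf : (0 : ℝ) < Nat.factorial (2 * n) := by exact_mod_cast Nat.factorial_pos _
    simp only [t]
    rw [show ((n + 1 : ℕ) : ℝ) + 3 / 4 = (n + 3 / 4) + 1 by push_cast; ring,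
      Real.Gamma_add_one hpos.ne', show 2 * (n + 1) = 2 * n + 1 + 1 by ring,
      Nat.factorial_succ (2 * n + 1 + 1), Nat.factorial_succ (2 * n + 1), pow_succ]
    push_cast
    field_simp
    ring
  obtain ⟨hs, hsum⟩ := hasSum_of_kummer_recurrence (by norm_num) ht (-(κ ^ 2 / 8))
  have hterm (n : ℕ) : (-1) ^ n * κ ^ (2 * n + 1) / (Nat.factorial (2 * n + 1) : ℝ) *
      (Real.Gamma (n + ((1 : ℝ) / 2 + 1) / 2) / 2) = t n * (-(κ ^ 2 / 8)) ^ n := by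
    rw [show ((1 : ℝ) / 2 + 1) / 2 = 3 / 4 by norm_num, neg_pow (κ ^ 2 / 8), div_pow, ← pow_mul]
    simp only [t]
    field_simp
    ring
  have hf (z : ℝ) : HasSum (fun n : ℕ =>
      (-1) ^ n * κ ^ (2 * n + 1) / (Nat.factorial (2 * n + 1) : ℝ) * z ^ (2 * n))
      (if z = 0 then κ else z⁻¹ * Real.sin (z * κ)) := by
    split_ifs with hz
    · subst hz
      convert! hasSum_ite_eq 0 κ using 2 with n
      rcases n with _ | n <;> simp
    · convert! (Real.hasSum_sin (z * κ)).mul_left z⁻¹ using 2 with n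
      rw [mul_pow, pow_succ z]
      field_simp
  have key := hasSum_integral_exp_neg_sq_mul_rpow (q := (1 : ℝ) / 2) (by norm_num) hf
    (by simpa only [hterm] using hs)
  simp only [hterm] at key
  have hcongr : ∫ z in Set.Ioi (0 : ℝ),
      Real.exp (-z ^ 2) * z ^ (-(1 : ℝ) / 2) * Real.sin (z * κ) =
      ∫ z in Set.Ioi (0 : ℝ), Real.exp (-z ^ 2) * z ^ ((1 : ℝ) / 2) *
        (if z = 0 then κ else z⁻¹ * Real.sin (z * κ)) := by
    refine setIntegral_congr_fun measurableSet_Ioi fun z hz => ?_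
    have hz0 : (0 : ℝ) < z := hz
    simp only [hz0.ne', if_false]
    rw [show -(1 : ℝ) / 2 = 1 / 2 - 1 by norm_num, Real.rpow_sub_one hz0.ne']
    ring
  have hG : Real.Gamma (1 / 4 + 1) = 1 / 4 * Real.Gamma (1 / 4) :=
    Real.Gamma_add_one (by norm_num)
  rw [hcongr, key.unique hsum, hG]
  simp only [pow_mul, neg_sq, t]
  generalize (∑' k : ℕ, _ : ℝ) = S
  norm_num
  exact Or.inl (by ring)

theorem Gamma_one_fourth_mul_Gamma_three_fourths :
    Real.Gamma (1 / 4) * Real.Gamma (3 / 4) = π * √2 := by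
  have h := Real.Gamma_mul_Gamma_one_sub (1 / 4)
  rw [show (1 : ℝ) - 1 / 4 = 3 / 4 by norm_num, show π * (1 / 4) = π / 4 by ring,
    Real.sin_pi_div_four] at h
  rw [h]
  have h2 : √2 * √2 = (2 : ℝ) := Real.mul_self_sqrt (by norm_num)
  have h0 : √2 ≠ (0 : ℝ) := by positivity
  field_simp
  linarith

theorem abs_rpow_half_mul_rpow_one_fourth (κ : ℝ) :
    |κ| ^ ((1 : ℝ) / 2) * (κ ^ 2 / 8 / 2) ^ ((1 : ℝ) / 4) = |κ| / 2 := by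
  have h : κ ^ 2 / 8 / 2 = (|κ| / 4) ^ (2 : ℝ) := by
    rw [Real.rpow_two, div_pow, sq_abs]; ring
  have h4 : (4 : ℝ) ^ ((1 : ℝ) / 2) = 2 := by
    rw [← Real.sqrt_eq_rpow, show (4 : ℝ) = 2 ^ 2 by norm_num]
    exact Real.sqrt_sq (by norm_num)
  rw [h, ← Real.rpow_mul (by positivity), show (2 : ℝ) * (1 / 4) = 1 / 2 by norm_num,
    Real.div_rpow (abs_nonneg _) (by norm_num), h4, ← mul_div_assoc, ← Real.sqrt_eq_rpow,
    Real.mul_self_sqrt (abs_nonneg _)]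

theorem abs_rpow_half_mul_rpow_neg_one_fourth {κ : ℝ} (hκ : κ ≠ 0) :
    |κ| ^ ((1 : ℝ) / 2) * (κ ^ 2 / 8 / 2) ^ (-((1 : ℝ) / 4)) = 2 := by
  have h := abs_rpow_half_mul_rpow_one_fourth κ
  have hpos : (0 : ℝ) < |κ| := abs_pos.mpr hκ
  have hp : 0 < (κ ^ 2 / 8 / 2) ^ ((1 : ℝ) / 4) := by positivity
  have hs : |κ| ^ ((1 : ℝ) / 2) * |κ| ^ ((1 : ℝ) / 2) = |κ| := by
    rw [← Real.sqrt_eq_rpow, Real.mul_self_sqrt hpos.le]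
  have hs0 : 0 < |κ| ^ ((1 : ℝ) / 2) := by positivity
  rw [Real.rpow_neg (by positivity), ← div_eq_mul_inv, div_eq_iff hp.ne']
  apply mul_left_cancel₀ hs0.ne'
  linarith

/-- The profile function `Φ₁(κ) = ∫_0^∞ e^{−z²} z^{−1/2} sin(π/4 − zκ) dz` expressed through
modified Bessel functions, with `η = κ²/8`. -/
theorem phi1_bessel_formula (κ : ℝ) (hκ : κ ≠ 0) :
    ∫ z in Set.Ioi (0 : ℝ), Real.exp (-z ^ 2) * z ^ (-(1 : ℝ) / 2) * Real.sin (π / 4 - z * κ) =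
      (π / 4) * Real.exp (-(κ ^ 2 / 8)) * |κ| ^ ((1 : ℝ) / 2) *
        (besselI (-(1 / 4)) (κ ^ 2 / 8) - Real.sign κ * besselI (1 / 4) (κ ^ 2 / 8)) := by
  have hw := integrableOn_exp_neg_sq_mul_rpow (q := -(1 : ℝ) / 2) (by norm_num)
  have hcos : IntegrableOn (fun z : ℝ =>
      Real.exp (-z ^ 2) * z ^ (-(1 : ℝ) / 2) * Real.cos (z * κ)) (Set.Ioi 0) :=
    hw.mul_bdd (c := 1) (by fun_prop) (.of_forall fun z => Real.abs_cos_le_one _)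
  have hsin : IntegrableOn (fun z : ℝ =>
      Real.exp (-z ^ 2) * z ^ (-(1 : ℝ) / 2) * Real.sin (z * κ)) (Set.Ioi 0) :=
    hw.mul_bdd (c := 1) (by fun_prop) (.of_forall fun z => Real.abs_sin_le_one _)
  have hsplit (z : ℝ) :
      Real.exp (-z ^ 2) * z ^ (-(1 : ℝ) / 2) * Real.sin (π / 4 - z * κ) =
      √2 / 2 * (Real.exp (-z ^ 2) * z ^ (-(1 : ℝ) / 2) * Real.cos (z * κ) -
        Real.exp (-z ^ 2) * z ^ (-(1 : ℝ) / 2) * Real.sin (z * κ)) := by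
    rw [Real.sin_sub, Real.sin_pi_div_four, Real.cos_pi_div_four]
    ring
  have hη : 0 < κ ^ 2 / 8 := by positivity
  have hsign : Real.sign κ * |κ| = κ := by
    rcases lt_or_gt_of_ne hκ with h | h
    · simp [Real.sign_of_neg h, abs_of_neg h]
    · simp [Real.sign_of_pos h, abs_of_pos h]
  have h2 : √2 * √2 = (2 : ℝ) := Real.mul_self_sqrt (by norm_num)
  simp_rw [hsplit]
  rw [integral_const_mul, integral_sub hcos hsin, integral_exp_neg_sq_mul_rpow_mul_cos,
    integral_exp_neg_sq_mul_rpow_mul_sin, Gamma_one_fourth_mul_Gamma_three_fourths,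
    besselI_eq_rpow_mul_tsum _ hη, besselI_eq_rpow_mul_tsum _ hη]
  set A := ∑' k : ℕ, besselCoeff (-(1 / 4)) k * (κ ^ 2 / 8) ^ (2 * k)
  set B := ∑' k : ℕ, besselCoeff (1 / 4) k * (κ ^ 2 / 8) ^ (2 * k)
  set E := Real.exp (-(κ ^ 2 / 8))
  linear_combination (E * π * A / 4 - κ * E * π * B / 16) * h2
    - π / 4 * E * A * abs_rpow_half_mul_rpow_neg_one_fourth hκ
    + π / 4 * E * B * Real.sign κ * abs_rpow_half_mul_rpow_one_fourth κ
    + π / 8 * E * B * hsign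
end

section
/- For every real κ, the exact identity ∫_0^∞ e^{−z²} z^{3/2} sin(zκ − π/4) dz = −(1/4) ∫_0^∞ e^{−z²} z^{−1/2} sin(π/4 − zκ) dz + (κ/2) ∫_0^∞ e^{−z²} z^{1/2} sin(zκ + π/4) dz holds; that is, Φ₃(κ) = −Φ₁(κ)/4 + (κ/2)·Φ₂(κ). -/
open Real MeasureTheory

open Filter Topology in
theorem tendsto_exp_neg_sq_mul_rpow_mul_sin (s κ c : ℝ) :
    Tendsto (fun z : ℝ => Real.exp (-z ^ 2) * z ^ s * Real.sin (z * κ + c)) atTop (𝓝 0) := by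
  have h := (rpow_mul_exp_neg_mul_sq_isLittleO_exp_neg one_pos s).trans_tendsto
    (Real.tendsto_exp_atBot.comp (tendsto_id.const_mul_atTop_of_neg
      (show (-(1 / 2) : ℝ) < 0 by norm_num)))
  refine squeeze_zero_norm (fun z => ?_) (tendsto_zero_iff_norm_tendsto_zero.mp h)
  rw [norm_mul, neg_one_mul, mul_comm (z ^ s)]
  exact mul_le_of_le_one_right (norm_nonneg _) (Real.abs_sin_le_one _)

theorem integrableOn_exp_neg_sq_mul_rpow_mul {s : ℝ} (hs : -1 < s) {g : ℝ → ℝ}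
    (hg : Continuous g) (hb : ∀ z, |g z| ≤ 1) :
    IntegrableOn (fun z : ℝ => Real.exp (-z ^ 2) * z ^ s * g z) (Set.Ioi 0) := by
  have h : IntegrableOn (fun z : ℝ => Real.exp (-z ^ 2) * z ^ s) (Set.Ioi 0) := by
    simpa only [neg_one_mul, mul_comm (Real.exp _)] using
      integrableOn_rpow_mul_exp_neg_mul_sq one_pos hs
  exact h.mul_bdd hg.aestronglyMeasurable (Filter.Eventually.of_forall hb)

theorem hasDerivAt_exp_neg_sq_mul_sqrt_mul_sin (κ : ℝ) {z : ℝ} (hz : 0 < z) :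
    HasDerivAt (fun z : ℝ => Real.exp (-z ^ 2) * z ^ ((1 : ℝ) / 2) * Real.sin (z * κ + -(π / 4)))
      (-2 * (Real.exp (-z ^ 2) * z ^ ((3 : ℝ) / 2) * Real.sin (z * κ - π / 4)) -
        1 / 2 * (Real.exp (-z ^ 2) * z ^ (-(1 : ℝ) / 2) * Real.sin (π / 4 - z * κ)) +
        κ * (Real.exp (-z ^ 2) * z ^ ((1 : ℝ) / 2) * Real.sin (z * κ + π / 4))) z := by
  have hexp : HasDerivAt (fun z : ℝ => Real.exp (-z ^ 2)) (Real.exp (-z ^ 2) * -(2 * z)) z := by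
    simpa using ((hasDerivAt_pow 2 z).neg).exp
  have hpow := Real.hasDerivAt_rpow_const (x := z) (p := (1 : ℝ) / 2) (Or.inl hz.ne')
  have hsin : HasDerivAt (fun z : ℝ => Real.sin (z * κ + -(π / 4)))
      (Real.cos (z * κ + -(π / 4)) * κ) z := by
    simpa using (((hasDerivAt_id z).mul_const κ).add_const (-(π / 4))).sin
  refine ((hexp.mul hpow).mul hsin).congr_deriv ?_
  have h3 : z ^ ((3 : ℝ) / 2) = z ^ ((1 : ℝ) / 2) * z := by
    rw [← Real.rpow_add_one hz.ne']; norm_num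
  have h1 : (1 : ℝ) / 2 - 1 = -1 / 2 := by norm_num
  have hs : Real.sin (π / 4 - z * κ) = -Real.sin (z * κ + -(π / 4)) := by
    rw [← Real.sin_neg]; congr 1; ring
  have hc : Real.sin (z * κ + π / 4) = Real.cos (z * κ + -(π / 4)) := by
    rw [← Real.cos_pi_div_two_sub, ← Real.cos_neg]; congr 1; ring
  rw [h3, h1, hs, hc, sub_eq_add_neg (z * κ)]
  simp only [Pi.mul_apply]
  ring

/-- The identity `Φ₃(κ) = −Φ₁(κ)/4 + (κ/2)·Φ₂(κ)` relating the acceleration profile near the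
quasi-front to the displacement and velocity profiles. -/
theorem phi3_eq_phi1_phi2 (κ : ℝ) :
    (∫ z in Set.Ioi (0 : ℝ), Real.exp (-z ^ 2) * z ^ ((3 : ℝ) / 2) * Real.sin (z * κ - π / 4)) =
      -(1 / 4) * (∫ z in Set.Ioi (0 : ℝ),
          Real.exp (-z ^ 2) * z ^ (-(1 : ℝ) / 2) * Real.sin (π / 4 - z * κ)) +
        (κ / 2) * (∫ z in Set.Ioi (0 : ℝ),
          Real.exp (-z ^ 2) * z ^ ((1 : ℝ) / 2) * Real.sin (z * κ + π / 4)) := by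
  have i3 := integrableOn_exp_neg_sq_mul_rpow_mul (s := (3 : ℝ) / 2) (by norm_num)
    (g := fun z => Real.sin (z * κ - π / 4)) (by fun_prop) (fun _ => Real.abs_sin_le_one _)
  have i1 := integrableOn_exp_neg_sq_mul_rpow_mul (s := -(1 : ℝ) / 2) (by norm_num)
    (g := fun z => Real.sin (π / 4 - z * κ)) (by fun_prop) (fun _ => Real.abs_sin_le_one _)
  have i2 := integrableOn_exp_neg_sq_mul_rpow_mul (s := (1 : ℝ) / 2) (by norm_num)
    (g := fun z => Real.sin (z * κ + π / 4)) (by fun_prop) (fun _ => Real.abs_sin_le_one _)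
  have hcont : Continuous fun z : ℝ =>
      Real.exp (-z ^ 2) * z ^ ((1 : ℝ) / 2) * Real.sin (z * κ + -(π / 4)) := by
    have := Real.continuous_rpow_const (q := (1 : ℝ) / 2) (by norm_num)
    fun_prop
  have j3 := i3.const_mul (-2)
  have j1 := i1.const_mul (1 / 2)
  have j2 := i2.const_mul κ
  have key := integral_Ioi_of_hasDerivAt_of_tendsto hcont.continuousWithinAt
    (fun z hz => hasDerivAt_exp_neg_sq_mul_sqrt_mul_sin κ hz) ((j3.sub j1).add j2)
    (tendsto_exp_neg_sq_mul_rpow_mul_sin _ κ _)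
  rw [integral_add, integral_sub j3 j1, integral_const_mul, integral_const_mul,
    integral_const_mul, Real.zero_rpow (by norm_num : (1 : ℝ) / 2 ≠ 0)] at key
  · linarith
  · exact j3.sub j1
  · exact j2
end

section
/- Fix κ ∈ ℝ. For all sequences (t_j) of positive reals with t_j → ∞ and all sequences (n_j) of natural numbers such that (n_j − t_j)/( (t_j/2)^{1/3} ) → κ, one has (t_j/2)^{1/3} · J_{n_j}(t_j) → Ai(κ) as j → ∞. -/
open Real Filter Topology

/-- The Bessel function of the first kind of integer order `n`:
`J_n(x) = (1/π) ∫_0^π cos(nθ − x sin θ) dθ`. -/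
noncomputable def besselJ (n : ℕ) (x : ℝ) : ℝ :=
  (1 / π) * ∫ θ in (0 : ℝ)..π, Real.cos (n * θ - x * Real.sin θ)

/-- The Airy function `Ai(x) = (1/π) lim_{R→∞} ∫_0^R cos(t³/3 + x t) dt`. -/
noncomputable def airyAi (x : ℝ) : ℝ :=
  (1 / π) * limUnder atTop (fun R : ℝ => ∫ t in (0 : ℝ)..R, Real.cos (t ^ 3 / 3 + x * t))

/-- First-derivative test of van der Corput: if the phase `φ` has a positive nondecreasing
derivative on `[a, b]`, then `|∫ cos φ| ≤ 2 / φ'(a)`. -/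
lemma abs_integral_cos_le_of_monotone_deriv {φ φ' φ'' : ℝ → ℝ} {a b : ℝ} (hab : a ≤ b)
    (h1 : ∀ x, HasDerivAt φ (φ' x) x) (h2 : ∀ x, HasDerivAt φ' (φ'' x) x)
    (hc : Continuous φ'') (hpos : ∀ x ∈ Set.Icc a b, 0 < φ' x)
    (hconv : ∀ x ∈ Set.Icc a b, 0 ≤ φ'' x) :
    |∫ x in a..b, Real.cos (φ x)| ≤ 2 / φ' a := by
  have cφ : Continuous φ := continuous_iff_continuousAt.2 fun x => (h1 x).continuousAt
  have cφ' : Continuous φ' := continuous_iff_continuousAt.2 fun x => (h2 x).continuousAt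
  have hu : Set.uIcc a b = Set.Icc a b := Set.uIcc_of_le hab
  have hne : ∀ x ∈ Set.uIcc a b, φ' x ≠ 0 := fun x hx => (hpos x (hu ▸ hx)).ne'
  have iH : IntervalIntegrable (fun x => φ'' x / φ' x ^ 2) MeasureTheory.volume a b :=
    (hc.continuousOn.div (cφ'.pow 2).continuousOn
      fun x hx => pow_ne_zero 2 (hne x hx)).intervalIntegrable
  have iG : IntervalIntegrable (fun x => Real.sin (φ x) * (φ'' x / φ' x ^ 2))
      MeasureTheory.volume a b :=
    iH.continuousOn_mul (Real.continuous_sin.comp cφ).continuousOn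
  have iC : IntervalIntegrable (fun x => Real.cos (φ x)) MeasureTheory.volume a b :=
    (Real.continuous_cos.comp cφ).intervalIntegrable _ _
  have e1 : ∫ x in a..b, φ'' x / φ' x ^ 2 = -(φ' b)⁻¹ - -(φ' a)⁻¹ := by
    refine intervalIntegral.integral_eq_sub_of_hasDerivAt (f := fun x => -(φ' x)⁻¹) ?_ iH
    intro x hx
    exact ((h2 x).fun_inv (hne x hx)).fun_neg.congr_deriv (by ring)
  have e2 : ∫ x in a..b, (Real.cos (φ x) - Real.sin (φ x) * (φ'' x / φ' x ^ 2)) =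
      Real.sin (φ b) / φ' b - Real.sin (φ a) / φ' a := by
    refine intervalIntegral.integral_eq_sub_of_hasDerivAt
      (f := fun x => Real.sin (φ x) / φ' x) ?_ (iC.sub iG)
    intro x hx
    refine ((h1 x).sin.fun_div (h2 x) (hne x hx)).congr_deriv ?_
    have := hne x hx
    field_simp
  rw [intervalIntegral.integral_sub iC iG] at e2
  have e3 : |∫ x in a..b, Real.sin (φ x) * (φ'' x / φ' x ^ 2)| ≤ ∫ x in a..b, φ'' x / φ' x ^ 2 := by
    rw [← Real.norm_eq_abs]
    refine intervalIntegral.norm_integral_le_of_norm_le hab ?_ iH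
    refine Filter.Eventually.of_forall fun x hx => ?_
    have h0 : 0 ≤ φ'' x / φ' x ^ 2 := div_nonneg (hconv x ⟨hx.1.le, hx.2⟩) (sq_nonneg _)
    rw [Real.norm_eq_abs, abs_mul, abs_of_nonneg h0]
    exact mul_le_of_le_one_left h0 (Real.abs_sin_le_one _)
  have hb : ∀ x ∈ Set.Icc a b, |Real.sin (φ x) / φ' x| ≤ (φ' x)⁻¹ := by
    intro x hx
    rw [abs_div, abs_of_pos (hpos x hx), div_eq_mul_inv]
    exact mul_le_of_le_one_left (inv_nonneg.2 (hpos x hx).le) (Real.abs_sin_le_one _)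
  have ha' := abs_le.1 (hb a ⟨le_rfl, hab⟩)
  have hb' := abs_le.1 (hb b ⟨hab, le_rfl⟩)
  have e3' := abs_le.1 e3
  rw [div_eq_mul_inv, abs_le]
  constructor <;> linarith [e3'.1, e3'.2, ha'.1, ha'.2, hb'.1, hb'.2]

lemma abs_integral_airy_tail_le {κ R S : ℝ} (hR : 0 ≤ R) (hκ : |κ| + 1 < R ^ 2 / 4)
    (hRS : R ≤ S) :
    |∫ s in R..S, Real.cos (s ^ 3 / 3 + κ * s)| ≤ 2 / (R ^ 2 / 4 - (|κ| + 1)) := by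
  have hk := neg_abs_le κ
  have hpos : ∀ x ∈ Set.Icc R S, 0 < x ^ 2 + κ := fun x hx => by
    have : R ^ 2 ≤ x ^ 2 := pow_le_pow_left₀ hR hx.1 2
    nlinarith
  refine (abs_integral_cos_le_of_monotone_deriv (φ' := fun s => s ^ 2 + κ)
    (φ'' := fun s => 2 * s) hRS (fun x => ?_) (fun x => ?_) (by fun_prop) hpos
    (fun x hx => by have := hx.1; linarith)).trans ?_
  · exact (((hasDerivAt_pow 3 x).div_const 3).fun_add
      ((hasDerivAt_id x).const_mul κ)).congr_deriv (by norm_num)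
  · simpa using (hasDerivAt_pow 2 x).add_const κ
  · exact div_le_div_of_nonneg_left (by norm_num) (by linarith) (by nlinarith)

/-- The phase `nθ - x sin θ` of the Bessel integral at `θ = s / m`, with `x = 2m³` and
`n = x + k m`. -/
noncomputable def besselPhase (m k s : ℝ) : ℝ :=
  k * s + 2 * m ^ 3 * (s / m - Real.sin (s / m))

lemma abs_integral_besselPhase_tail_le {κ m k R : ℝ} (hm : 0 < m) (hk : |k - κ| ≤ 1) (hR : 0 ≤ R)
    (hκ : |κ| + 1 < R ^ 2 / 4) (hRm : R ≤ π * m) :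
    |∫ s in R..π * m, Real.cos (besselPhase m k s)| ≤ 2 / (R ^ 2 / 4 - (|κ| + 1)) := by
  have hkl := (abs_le.1 hk).1
  have hκl := neg_abs_le κ
  have hlow : ∀ x ∈ Set.Icc R (π * m),
      R ^ 2 / 4 - (|κ| + 1) ≤ k + 2 * m ^ 2 * (1 - Real.cos (x / m)) := by
    intro x hx
    have hx0 : 0 ≤ x := hR.trans hx.1
    have hxm : |x / m| ≤ π := by
      rw [abs_of_nonneg (by positivity), div_le_iff₀ hm]
      exact hx.2
    have hcos := Real.cos_le_one_sub_mul_cos_sq hxm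
    have hsq : R ^ 2 ≤ x ^ 2 := pow_le_pow_left₀ hR hx.1 2
    have h1 : 2 * m ^ 2 * (2 / π ^ 2 * (x / m) ^ 2) ≤ 2 * m ^ 2 * (1 - Real.cos (x / m)) := by
      gcongr
      linarith
    have h2 : 2 * m ^ 2 * (2 / π ^ 2 * (x / m) ^ 2) = 4 * x ^ 2 / π ^ 2 := by
      have := Real.pi_pos
      field_simp
      ring
    have h3 : x ^ 2 / 4 ≤ 4 * x ^ 2 / π ^ 2 := by
      rw [div_le_div_iff₀ (by norm_num) (by positivity)]
      have h4 : π ^ 2 ≤ 4 ^ 2 := pow_le_pow_left₀ Real.pi_pos.le Real.pi_le_four 2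
      nlinarith [sq_nonneg x]
    linarith
  have hd : ∀ x, HasDerivAt (fun s : ℝ => s / m) (1 / m) x := fun x =>
    (hasDerivAt_id x).div_const m
  refine (abs_integral_cos_le_of_monotone_deriv
    (φ' := fun s => k + 2 * m ^ 2 * (1 - Real.cos (s / m)))
    (φ'' := fun s => 2 * m * Real.sin (s / m)) hRm (fun x => ?_) (fun x => ?_) (by fun_prop)
    (fun x hx => lt_of_lt_of_le (by linarith) (hlow x hx)) (fun x hx => ?_)).trans ?_
  · unfold besselPhase
    refine (((hasDerivAt_id x).const_mul k).fun_add
      (((hd x).fun_sub (hd x).sin).const_mul (2 * m ^ 3))).congr_deriv ?_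
    field_simp
  · refine ((((hd x).cos.const_sub 1).const_mul (2 * m ^ 2)).const_add k).congr_deriv ?_
    field_simp
  · have : 0 ≤ Real.sin (x / m) := Real.sin_nonneg_of_nonneg_of_le_pi
      (div_nonneg (hR.trans hx.1) hm.le) ((div_le_iff₀ hm).2 hx.2)
    positivity
  · exact div_le_div_of_nonneg_left (by norm_num) (by linarith) (hlow R ⟨le_rfl, hRm⟩)

lemma tendsto_besselPhase {ι : Type*} {l : Filter ι} {m k : ι → ℝ} {κ : ℝ}
    (hm : Tendsto m l atTop) (hk : Tendsto k l (𝓝 κ)) (s : ℝ) :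
    Tendsto (fun i => besselPhase (m i) (k i) s) l (𝓝 (s ^ 3 / 3 + κ * s)) := by
  have hrem : Tendsto (fun i => 2 * m i ^ 3 * (s / m i - Real.sin (s / m i)) - s ^ 3 / 3) l
      (𝓝 0) := by
    refine squeeze_zero_norm' (a := fun i => |s| ^ 5 / 50 / m i ^ 2) ?_
      (((tendsto_pow_atTop two_ne_zero).comp hm).const_div_atTop _)
    filter_upwards [hm.eventually_ge_atTop |s|, hm.eventually_gt_atTop 0] with i hi hpos
    have hle : |s / m i| ≤ 1 := by
      rw [abs_div, abs_of_pos hpos]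
      exact (div_le_one hpos).2 hi
    have hsin := Real.sin_bound hle
    have heq : 2 * m i ^ 3 * (s / m i - Real.sin (s / m i)) - s ^ 3 / 3 =
        -(2 * m i ^ 3) * (Real.sin (s / m i) - (s / m i - (s / m i) ^ 3 / 6)) := by
      field_simp
      ring
    rw [heq, norm_mul, Real.norm_eq_abs, Real.norm_eq_abs, abs_neg,
      abs_of_pos (by positivity : 0 < 2 * m i ^ 3)]
    refine (mul_le_mul_of_nonneg_left hsin (by positivity)).trans_eq ?_
    rw [abs_div, abs_of_pos hpos]
    field_simp
    ring
  have := ((hk.mul_const s).add hrem).add_const (s ^ 3 / 3)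
  convert this using 2
  · unfold besselPhase
    ring
  · ring

lemma continuous_besselPhase (m k : ℝ) : Continuous (besselPhase m k) := by
  unfold besselPhase
  fun_prop

lemma tendsto_two_div_sq_sub (B : ℝ) :
    Tendsto (fun R : ℝ => 2 / (R ^ 2 / 4 - B)) atTop (𝓝 0) :=
  (tendsto_atTop_add_const_right _ (-B)
    ((tendsto_pow_atTop two_ne_zero).atTop_div_const (by norm_num))).const_div_atTop 2

lemma eventually_lt_sq_div_four (B : ℝ) : ∀ᶠ R : ℝ in atTop, B < R ^ 2 / 4 :=
  ((tendsto_pow_atTop two_ne_zero).atTop_div_const (by norm_num)).eventually_gt_atTop B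

lemma integral_airy_sub (κ R S : ℝ) :
    (∫ s in (0 : ℝ)..S, Real.cos (s ^ 3 / 3 + κ * s)) -
      ∫ s in (0 : ℝ)..R, Real.cos (s ^ 3 / 3 + κ * s) =
      ∫ s in R..S, Real.cos (s ^ 3 / 3 + κ * s) :=
  intervalIntegral.integral_interval_sub_left
    ((by fun_prop : Continuous _).intervalIntegrable _ _)
    ((by fun_prop : Continuous _).intervalIntegrable _ _)

/-- The improper integral defining the Airy function converges. -/
lemma tendsto_integral_airy (κ : ℝ) :
    Tendsto (fun R : ℝ => ∫ s in (0 : ℝ)..R, Real.cos (s ^ 3 / 3 + κ * s)) atTop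
      (𝓝 (limUnder atTop fun R : ℝ => ∫ s in (0 : ℝ)..R, Real.cos (s ^ 3 / 3 + κ * s))) := by
  refine CauchySeq.tendsto_limUnder (Metric.cauchySeq_iff'.2 fun ε hε => ?_)
  obtain ⟨R, h0, h1, h2⟩ := ((eventually_ge_atTop (0 : ℝ)).and
    ((eventually_lt_sq_div_four (|κ| + 1)).and
      ((tendsto_two_div_sq_sub (|κ| + 1)).eventually_lt_const hε))).exists
  refine ⟨R, fun S hS => ?_⟩
  rw [Real.dist_eq, integral_airy_sub]
  exact (abs_integral_airy_tail_le h0 h1 hS).trans_lt h2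

lemma tendsto_integral_besselPhase {m k : ℕ → ℝ} {κ : ℝ}
    (hm : Tendsto m atTop atTop) (hk : Tendsto k atTop (𝓝 κ)) :
    Tendsto (fun j => ∫ s in (0 : ℝ)..π * m j, Real.cos (besselPhase (m j) (k j) s)) atTop
      (𝓝 (limUnder atTop fun R : ℝ => ∫ s in (0 : ℝ)..R, Real.cos (s ^ 3 / 3 + κ * s))) := by
  refine Metric.tendsto_nhds.2 fun ε hε => ?_
  have hε3 : 0 < ε / 3 := by positivity
  obtain ⟨R, h0, h1, h2, h3⟩ := ((eventually_ge_atTop (0 : ℝ)).and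
    ((eventually_lt_sq_div_four (|κ| + 1)).and
      (((tendsto_two_div_sq_sub (|κ| + 1)).eventually_lt_const hε3).and
        (Metric.tendsto_nhds.1 (tendsto_integral_airy κ) _ hε3)))).exists
  have hfin : Tendsto (fun j => ∫ s in (0 : ℝ)..R, Real.cos (besselPhase (m j) (k j) s)) atTop
      (𝓝 (∫ s in (0 : ℝ)..R, Real.cos (s ^ 3 / 3 + κ * s))) := by
    refine intervalIntegral.tendsto_integral_filter_of_dominated_convergence (fun _ => 1)
      (Eventually.of_forall fun j =>
        (Real.continuous_cos.comp (continuous_besselPhase _ _)).aestronglyMeasurable)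
      (Eventually.of_forall fun j => Eventually.of_forall fun s _ => Real.abs_cos_le_one _)
      intervalIntegrable_const
      (Eventually.of_forall fun s _ =>
        (Real.continuous_cos.tendsto _).comp (tendsto_besselPhase hm hk s))
  filter_upwards [Metric.tendsto_nhds.1 hfin _ hε3, hm.eventually_gt_atTop 0,
    (hm.const_mul_atTop Real.pi_pos).eventually_ge_atTop R,
    Metric.tendsto_nhds.1 hk 1 one_pos] with j hj hpos hRm hkj
  have htail := (abs_integral_besselPhase_tail_le hpos hkj.le h0 h1 hRm).trans_lt h2
  have hint : ∀ a b, IntervalIntegrable (fun s => Real.cos (besselPhase (m j) (k j) s))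
      MeasureTheory.volume a b := fun a b =>
    (Real.continuous_cos.comp (continuous_besselPhase _ _)).intervalIntegrable a b
  rw [← intervalIntegral.integral_interval_sub_left (hint 0 _) (hint 0 R), ← Real.dist_eq] at htail
  calc _ ≤ _ := dist_triangle4 _ _ _ _
    _ < ε / 3 + ε / 3 + ε / 3 := add_lt_add (add_lt_add htail hj) h3
    _ = ε := by ring

lemma mul_besselJ_eq_integral_besselPhase {m x : ℝ} (hm : 0 < m) (hx : x = 2 * m ^ 3) (n : ℕ) :
    m * besselJ n x =
      (1 / π) * ∫ s in (0 : ℝ)..π * m, Real.cos (besselPhase m ((n - x) / m) s) := by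
  have hsub := intervalIntegral.smul_integral_comp_mul_right (a := 0) (b := π)
    (fun s => Real.cos (besselPhase m ((n - x) / m) s)) m
  rw [zero_mul, smul_eq_mul] at hsub
  rw [← hsub, besselJ, mul_left_comm]
  congr 3
  funext θ
  congr 1
  rw [besselPhase, mul_div_cancel_right₀ _ hm.ne', hx]
  field_simp
  ring

/-- Transition-region asymptotics of the Bessel function near the quasi-front: if `t_j → ∞`
and `(n_j − t_j)/(t_j/2)^{1/3} → κ`, then `(t_j/2)^{1/3} J_{n_j}(t_j) → Ai(κ)`. -/
theorem besselJ_airy_transition (κ : ℝ) (t : ℕ → ℝ) (n : ℕ → ℕ)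
    (ht0 : ∀ j, 0 < t j) (ht : Tendsto t atTop atTop)
    (hn : Tendsto (fun j => ((n j : ℝ) - t j) / (t j / 2) ^ ((1 : ℝ) / 3)) atTop (𝓝 κ)) :
    Tendsto (fun j => (t j / 2) ^ ((1 : ℝ) / 3) * besselJ (n j) (t j)) atTop (𝓝 (airyAi κ)) := by
  have hm : Tendsto (fun j => (t j / 2) ^ ((1 : ℝ) / 3)) atTop atTop :=
    (tendsto_rpow_atTop (by norm_num)).comp (ht.atTop_div_const two_pos)
  refine ((tendsto_integral_besselPhase hm hn).const_mul (1 / π)).congr fun j => ?_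
  have hpos : 0 < t j / 2 := half_pos (ht0 j)
  refine (mul_besselJ_eq_integral_besselPhase (Real.rpow_pos_of_pos hpos _) ?_ (n j)).symm
  rw [← Real.rpow_natCast, ← Real.rpow_mul hpos.le]
  norm_num
  ring
end

section
/- Fix κ ∈ ℝ. For all sequences (t_j) of positive reals with t_j → ∞ and all sequences (n_j) of natural numbers such that (n_j − t_j)/( (t_j/2)^{1/3} ) → κ, one has (t_j/2)^{2/3} · J'_{n_j}(t_j) → −Ai'(κ) as j → ∞, where J'_n(x) denotes the derivative of J_n with respect to x and Ai' the derivative of Ai. -/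
open Real Filter Topology

/-- Differentiation under the integral sign for a cosine whose phase is affine in the parameter. -/
lemma hasDerivAt_integral_cos_affine {p q : ℝ → ℝ} (hp : Continuous p) (hq : Continuous q)
    (a b x : ℝ) :
    HasDerivAt (fun y => ∫ s in a..b, Real.cos (p s + y * q s))
      (∫ s in a..b, -(q s * Real.sin (p s + x * q s))) x := by
  refine (intervalIntegral.hasDerivAt_integral_of_dominated_loc_of_deriv_le
    (F := fun y s => Real.cos (p s + y * q s))
    (F' := fun y s => -(q s * Real.sin (p s + y * q s)))
    (bound := fun s => |q s|) (s := Set.univ) Filter.univ_mem ?_ ?_ ?_ ?_ ?_ ?_).2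
  · exact Filter.Eventually.of_forall fun y => (by fun_prop : Continuous _).aestronglyMeasurable
  · exact (by fun_prop : Continuous _).intervalIntegrable _ _
  · exact (by fun_prop : Continuous _).aestronglyMeasurable
  · refine Filter.Eventually.of_forall fun s _ y _ => ?_
    rw [norm_neg, norm_mul, Real.norm_eq_abs, Real.norm_eq_abs]
    exact mul_le_of_le_one_right (abs_nonneg _) (Real.abs_sin_le_one _)
  · exact (by fun_prop : Continuous _).intervalIntegrable _ _
  · refine Filter.Eventually.of_forall fun s _ y _ => ?_
    have h : HasDerivAt (fun y => p s + y * q s) (q s) y := by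
      simpa using ((hasDerivAt_id y).mul_const (q s)).const_add (p s)
    exact h.cos.congr_deriv (by ring)

/-- Integration by parts for an oscillatory integral. -/
lemma abs_integral_mul_deriv_mul_sin_le {a b A : ℝ} (ha : 0 < a) (hab : a ≤ b)
    {h h' ψ ψ' : ℝ → ℝ}
    (hh : ∀ s ∈ Set.Icc a b, HasDerivAt h (h' s) s)
    (hψ : ∀ s ∈ Set.Icc a b, HasDerivAt ψ (ψ' s) s)
    (hA : ∀ s ∈ Set.Icc a b, |h s| ≤ A / s)
    (hA' : ∀ s ∈ Set.Icc a b, |h' s| ≤ A / s ^ 2)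
    (ch' : ContinuousOn h' (Set.Icc a b)) (cψ' : ContinuousOn ψ' (Set.Icc a b)) :
    |∫ s in a..b, h s * (ψ' s * Real.sin (ψ s))| ≤ 2 * A / a := by
  have hb : 0 < b := ha.trans_le hab
  have hu : Set.uIcc a b = Set.Icc a b := Set.uIcc_of_le hab
  have cψ : ContinuousOn ψ (Set.Icc a b) := fun s hs => (hψ s hs).continuousAt.continuousWithinAt
  have key := intervalIntegral.integral_mul_deriv_eq_deriv_mul (a := a) (b := b)
    (u := h) (u' := h') (v := fun s => -Real.cos (ψ s)) (v' := fun s => ψ' s * Real.sin (ψ s))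
    (by rwa [hu])
    (by
      rw [hu]
      intro s hs
      exact (hψ s hs).cos.neg.congr_deriv (by ring))
    (ContinuousOn.intervalIntegrable (by rwa [hu]))
    (ContinuousOn.intervalIntegrable (by rw [hu]; exact cψ'.mul (Real.continuous_sin.comp_continuousOn cψ)))
  have hinv : ∀ s ∈ Set.uIcc a b, HasDerivAt (fun s : ℝ => -(A / s)) (A / s ^ 2) s := by
    intro s hs
    rw [hu] at hs
    have hs0 : s ≠ 0 := (ha.trans_le hs.1).ne'
    exact ((hasDerivAt_inv hs0).const_mul A).neg.congr_deriv (by ring)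
  have cinv : IntervalIntegrable (fun s : ℝ => A / s ^ 2) MeasureTheory.volume a b := by
    refine ContinuousOn.intervalIntegrable ?_
    rw [hu]
    refine continuousOn_const.div (by fun_prop) fun s hs => ?_
    exact pow_ne_zero _ (ha.trans_le hs.1).ne'
  have hint : |∫ s in a..b, h' s * -Real.cos (ψ s)| ≤ A / a - A / b := by
    have h1 := intervalIntegral.norm_integral_le_of_norm_le (μ := MeasureTheory.volume) hab
      (f := fun s => h' s * -Real.cos (ψ s)) (g := fun s => A / s ^ 2)
      (Filter.Eventually.of_forall fun s hs => by
        rw [norm_mul, norm_neg, Real.norm_eq_abs, Real.norm_eq_abs]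
        exact (mul_le_of_le_one_right (abs_nonneg _) (Real.abs_cos_le_one _)).trans
          (hA' s ⟨hs.1.le, hs.2⟩)) cinv
    rw [intervalIntegral.integral_eq_sub_of_hasDerivAt hinv cinv, Real.norm_eq_abs] at h1
    linarith
  have bdry : ∀ s ∈ Set.Icc a b, |h s * -Real.cos (ψ s)| ≤ A / s := fun s hs => by
    rw [abs_mul, abs_neg]
    exact (mul_le_of_le_one_right (abs_nonneg _) (Real.abs_cos_le_one _)).trans (hA s hs)
  have h1 := bdry a ⟨le_rfl, hab⟩
  have h2 := bdry b ⟨hab, le_rfl⟩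
  rw [key]
  rw [abs_le] at *
  have : 2 * A / a = A / a + A / a := by ring
  constructor <;> linarith [h1.1, h1.2, h2.1, h2.2, hint.1, hint.2]

/-- Tail estimate for an oscillatory integral whose phase derivative grows quadratically. -/
lemma abs_integral_mul_sin_le {a b K : ℝ} (hK : 1 ≤ K) (ha : 5 * K ≤ a) (hab : a ≤ b)
    {g g' ψ ψ' ψ'' P : ℝ → ℝ}
    (hg : ∀ s, HasDerivAt g (g' s) s) (hψ : ∀ s, HasDerivAt ψ (ψ' s) s)
    (hψ' : ∀ s, HasDerivAt ψ' (ψ'' s) s) (cg' : Continuous g') (cψ'' : Continuous ψ'')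
    (hgs : ∀ s ∈ Set.Icc a b, |g s| ≤ s) (hP : ∀ s ∈ Set.Icc a b, 2 / 5 * s ^ 2 ≤ P s)
    (hPψ : ∀ s ∈ Set.Icc a b, P s - K ≤ ψ' s)
    (hw : ∀ s ∈ Set.Icc a b, |g' s * ψ' s - g s * ψ'' s| ≤ P s + K) :
    |∫ s in a..b, g s * Real.sin (ψ s)| ≤ 8 / a := by
  have ha0 : 0 < a := by linarith
  have hs0 : ∀ s ∈ Set.Icc a b, 0 < s := fun s hs => ha0.trans_le hs.1
  have hPK : ∀ s ∈ Set.Icc a b, 10 * K ≤ P s := fun s hs => by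
    have : 5 * K ≤ s := ha.trans hs.1
    nlinarith [hP s hs]
  have hlow : ∀ s ∈ Set.Icc a b, 9 / 10 * P s ≤ ψ' s := fun s hs => by
    linarith [hPψ s hs, hPK s hs]
  have hpos : ∀ s ∈ Set.Icc a b, 0 < ψ' s := fun s hs => by
    linarith [hlow s hs, hPK s hs]
  have cg : Continuous g := continuous_iff_continuousAt.2 fun s => (hg s).continuousAt
  have cψ' : Continuous ψ' := continuous_iff_continuousAt.2 fun s => (hψ' s).continuousAt
  have main := abs_integral_mul_deriv_mul_sin_le (A := 4) ha0 hab
    (h := fun s => g s / ψ' s) (h' := fun s => (g' s * ψ' s - g s * ψ'' s) / ψ' s ^ 2)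
    (fun s hs => (hg s).div (hψ' s) (hpos s hs).ne') (fun s _ => hψ s)
    (fun s hs => by
      have h0 := hs0 s hs
      rw [abs_div, abs_of_pos (hpos s hs), div_le_div_iff₀ (hpos s hs) h0]
      nlinarith [hgs s hs, hlow s hs, hP s hs])
    (fun s hs => by
      have h0 := hs0 s hs
      have hp := hpos s hs
      rw [abs_div, abs_of_pos (pow_pos hp 2), div_le_div_iff₀ (pow_pos hp 2) (pow_pos h0 2)]
      have hP0 : 0 < P s := by linarith [hPK s hs]
      calc |g' s * ψ' s - g s * ψ'' s| * s ^ 2 ≤ (11 / 10 * P s) * (5 / 2 * P s) := by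
            gcongr
            · linarith [hw s hs, hPK s hs]
            · linarith [hP s hs]
        _ ≤ 4 * (9 / 10 * P s) ^ 2 := by nlinarith [sq_nonneg (P s)]
        _ ≤ 4 * ψ' s ^ 2 := by
            gcongr
            exact hlow s hs)
    (((cg'.mul cψ').sub (cg.mul cψ'')).continuousOn.div (cψ'.pow 2).continuousOn
      fun s hs => (pow_pos (hpos s hs) 2).ne') cψ'.continuousOn
  rw [show (8 : ℝ) / a = 2 * 4 / a by norm_num]
  convert main using 2
  refine intervalIntegral.integral_congr fun s hs => ?_
  rw [Set.uIcc_of_le hab] at hs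
  have := (hpos s hs).ne'
  field_simp

lemma hasDerivAt_airy_phase (x c s : ℝ) :
    HasDerivAt (fun s : ℝ => s ^ 3 / 3 + x * s + c) (s ^ 2 + x) s := by
  exact ((((hasDerivAt_id s).pow 3).div_const 3).add
    ((hasDerivAt_id s).const_mul x)).add_const c |>.congr_deriv (by simp)

lemma hasDerivAt_airy_phase_deriv (x s : ℝ) :
    HasDerivAt (fun s : ℝ => s ^ 2 + x) (2 * s) s := by
  simpa using ((hasDerivAt_id s).pow 2).add_const x

lemma abs_integral_mul_sin_airy_le {a b K x : ℝ} (hK : 1 ≤ K) (hx : |x| ≤ K) (ha : 5 * K ≤ a)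
    (hab : a ≤ b) : |∫ s in a..b, s * Real.sin (s ^ 3 / 3 + x * s)| ≤ 8 / a := by
  rw [abs_le] at hx
  refine abs_integral_mul_sin_le (P := fun s => s ^ 2) hK ha hab
    (fun s => hasDerivAt_id s) (fun s => by simpa using hasDerivAt_airy_phase x 0 s)
    (hasDerivAt_airy_phase_deriv x) continuous_const (by fun_prop) ?_ ?_ ?_ ?_
  · exact fun s hs => (abs_of_pos (by linarith [hs.1])).le
  · exact fun s hs => by nlinarith [sq_nonneg s]
  · exact fun s hs => by linarith [hx.1]
  · exact fun s hs => by
      rw [abs_le]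
      constructor <;> nlinarith [sq_nonneg s, hx.1, hx.2]

lemma abs_integral_cos_airy_le {a b K x : ℝ} (hK : 1 ≤ K) (hx : |x| ≤ K) (ha : 5 * K ≤ a)
    (hab : a ≤ b) : |∫ s in a..b, Real.cos (s ^ 3 / 3 + x * s)| ≤ 8 / a := by
  rw [abs_le] at hx
  have := abs_integral_mul_sin_le (g := fun _ => 1) (P := fun s => s ^ 2) hK ha hab
    (fun s => hasDerivAt_const s 1) (hasDerivAt_airy_phase x (π / 2))
    (hasDerivAt_airy_phase_deriv x) continuous_const (by fun_prop) ?_ ?_ ?_ ?_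
  · simpa [Real.sin_add_pi_div_two] using this
  · exact fun s hs => by rw [abs_one]; linarith [hs.1]
  · exact fun s hs => by nlinarith [sq_nonneg s]
  · exact fun s hs => by linarith [hx.1]
  · exact fun s hs => by
      rw [abs_le]
      constructor <;> nlinarith [sq_nonneg s, hs.1]

/-- An improper integral whose tails beyond `a ≥ c` are `O(1 / a)` converges at rate `O(1 / a)`. -/
lemma exists_tendsto_integral_of_tail_le {f : ℝ → ℝ} (hf : Continuous f) {c B : ℝ}
    (h : ∀ a b, c ≤ a → a ≤ b → |∫ s in a..b, f s| ≤ B / a) :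
    ∃ L, Tendsto (fun R => ∫ s in (0 : ℝ)..R, f s) atTop (𝓝 L) ∧
      ∀ R, c ≤ R → |L - ∫ s in (0 : ℝ)..R, f s| ≤ B / R := by
  have hsub : ∀ a b, (∫ s in (0 : ℝ)..b, f s) - ∫ s in (0 : ℝ)..a, f s = ∫ s in a..b, f s :=
    fun a b => intervalIntegral.integral_interval_sub_left
      (hf.intervalIntegrable _ _) (hf.intervalIntegrable _ _)
  have hB : Tendsto (fun R : ℝ => B / R) atTop (𝓝 0) := tendsto_const_nhds.div_atTop tendsto_id
  have hcau : CauchySeq fun R => ∫ s in (0 : ℝ)..R, f s := by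
    rw [Metric.cauchySeq_iff']
    intro ε hε
    obtain ⟨N, hN, hcN⟩ := ((hB.eventually_lt_const hε).and (eventually_ge_atTop c)).exists
    refine ⟨N, fun b hb => ?_⟩
    rw [Real.dist_eq, hsub]
    exact (h N b hcN hb).trans_lt hN
  obtain ⟨L, hL⟩ := cauchySeq_tendsto_of_complete hcau
  refine ⟨L, hL, fun R hR => ?_⟩
  refine le_of_tendsto (hL.sub_const _).abs ?_
  filter_upwards [eventually_ge_atTop R] with b hb
  rw [hsub]
  exact h R b hR hb

lemma airyAi_hasDerivAt (κ : ℝ) :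
    ∃ L, HasDerivAt airyAi (-(1 / π * L)) κ ∧
      Tendsto (fun R : ℝ => ∫ s in (0 : ℝ)..R, s * Real.sin (s ^ 3 / 3 + κ * s)) atTop (𝓝 L) := by
  set K := |κ| + 1 with hKdef
  have hK : 1 ≤ K := by linarith [abs_nonneg κ]
  have hball : ∀ x ∈ Metric.ball κ 1, |x| ≤ K := fun x hx => by
    rw [Metric.mem_ball, Real.dist_eq] at hx
    linarith [abs_sub_abs_le_abs_sub x κ]
  have hex : ∀ x, ∃ L, x ∈ Metric.ball κ 1 →
      Tendsto (fun R : ℝ => ∫ s in (0 : ℝ)..R, s * Real.sin (s ^ 3 / 3 + x * s)) atTop (𝓝 L) ∧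
      ∀ R, 5 * K ≤ R → |L - ∫ s in (0 : ℝ)..R, s * Real.sin (s ^ 3 / 3 + x * s)| ≤ 8 / R := by
    intro x
    by_cases hx : x ∈ Metric.ball κ 1
    · obtain ⟨L, hL⟩ := exists_tendsto_integral_of_tail_le
        (f := fun s => s * Real.sin (s ^ 3 / 3 + x * s)) (by fun_prop)
        fun a b ha hab => abs_integral_mul_sin_airy_le hK (hball x hx) ha hab
      exact ⟨L, fun _ => hL⟩
    · exact ⟨0, fun h => absurd h hx⟩
  choose L hL using hex
  have hκ : κ ∈ Metric.ball κ 1 := Metric.mem_ball_self one_pos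
  refine ⟨L κ, ?_, (hL κ hκ).1⟩
  have hunif : TendstoUniformlyOn
      (fun (R : ℝ) x => ∫ s in (0 : ℝ)..R, -(s * Real.sin (s ^ 3 / 3 + x * s)))
      (fun x => -L x) atTop (Metric.ball κ 1) := by
    rw [Metric.tendstoUniformlyOn_iff]
    intro ε hε
    have hB : Tendsto (fun R : ℝ => 8 / R) atTop (𝓝 0) := tendsto_const_nhds.div_atTop tendsto_id
    filter_upwards [hB.eventually_lt_const hε, eventually_ge_atTop (5 * K)] with R hR hKR x hx
    rw [Real.dist_eq, intervalIntegral.integral_neg, ← neg_sub', abs_neg]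
    exact ((hL x hx).2 R hKR).trans_lt hR
  have hder := hasDerivAt_of_tendstoUniformlyOn
    (g := fun x => limUnder atTop fun R : ℝ => ∫ s in (0 : ℝ)..R, Real.cos (s ^ 3 / 3 + x * s))
    Metric.isOpen_ball hunif
    (Filter.Eventually.of_forall fun R x _ => hasDerivAt_integral_cos_affine
      (p := fun s => s ^ 3 / 3) (q := fun s => s) (by fun_prop) (by fun_prop) 0 R x)
    (fun x hx => by
      obtain ⟨M, hM, -⟩ := exists_tendsto_integral_of_tail_le
        (f := fun s => Real.cos (s ^ 3 / 3 + x * s)) (by fun_prop)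
        fun a b ha hab => abs_integral_cos_airy_le hK (hball x hx) ha hab
      exact tendsto_nhds_limUnder ⟨M, hM⟩) hκ
  rw [neg_mul_eq_mul_neg]
  exact hder.const_mul (1 / π)

lemma deriv_besselJ (n : ℕ) (x : ℝ) :
    deriv (besselJ n) x =
      1 / π * ∫ θ in (0 : ℝ)..π, Real.sin θ * Real.sin (n * θ - x * Real.sin θ) := by
  have h := (hasDerivAt_integral_cos_affine (p := fun θ => n * θ) (q := fun θ => -Real.sin θ)
    (by fun_prop) (by fun_prop) 0 π x).const_mul (1 / π)
  simp only [mul_neg, ← sub_eq_add_neg, neg_mul, neg_neg] at h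
  exact h.deriv

lemma abs_integral_besselJ_tail_le {a b K k m : ℝ} (hK : 1 ≤ K) (hk : |k| ≤ K) (ha : 5 * K ≤ a)
    (hab : a ≤ b) (hm : 0 < m) (hb : b ≤ π * m) :
    |∫ s in a..b, m * Real.sin (s / m) *
      Real.sin (k * s + 2 * m ^ 3 * (s / m - Real.sin (s / m)))| ≤ 8 / a := by
  have hdiv : ∀ s : ℝ, HasDerivAt (fun s => s / m) (1 / m) s := fun s =>
    (hasDerivAt_id s).div_const m
  rw [abs_le] at hk
  refine abs_integral_mul_sin_le (P := fun s => 2 * m ^ 2 * (1 - Real.cos (s / m)))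
    (g' := fun s => Real.cos (s / m))
    (ψ' := fun s => k + 2 * m ^ 2 * (1 - Real.cos (s / m)))
    (ψ'' := fun s => 2 * m * Real.sin (s / m)) hK ha hab ?_ ?_ ?_ (by fun_prop) (by fun_prop)
    ?_ ?_ ?_ ?_
  · intro s
    exact ((hdiv s).sin.const_mul m).congr_deriv (by field_simp)
  · intro s
    exact (((hasDerivAt_id s).const_mul k).add
      (((hdiv s).sub (hdiv s).sin).const_mul (2 * m ^ 3))).congr_deriv (by field_simp)
  · intro s
    exact ((((hdiv s).cos.const_sub 1).const_mul (2 * m ^ 2)).const_add k).congr_deriv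
      (by field_simp)
  · intro s hs
    have hs0 : 0 < s := by linarith [hs.1]
    rw [abs_mul, abs_of_pos hm]
    calc m * |Real.sin (s / m)| ≤ m * |s / m| := by exact mul_le_mul_of_nonneg_left Real.abs_sin_le_abs hm.le
      _ = s := by rw [abs_of_pos (div_pos hs0 hm)]; field_simp
  · intro s hs
    have hs0 : 0 < s := by linarith [hs.1]
    have hsm : |s / m| ≤ π := by
      rw [abs_of_pos (div_pos hs0 hm), div_le_iff₀ hm]
      exact hs.2.trans hb
    have hc := Real.cos_le_one_sub_mul_cos_sq hsm
    have hπ : (π : ℝ) ^ 2 ≤ 10 := by nlinarith [Real.pi_lt_d2, Real.pi_pos]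
    calc 2 / 5 * s ^ 2 = 2 * m ^ 2 * (2 / 10 * (s / m) ^ 2) := by field_simp; norm_num
      _ ≤ 2 * m ^ 2 * (2 / π ^ 2 * (s / m) ^ 2) := by gcongr
      _ ≤ 2 * m ^ 2 * (1 - Real.cos (s / m)) := by gcongr; linarith
  · exact fun s hs => by linarith [hk.1]
  · intro s hs
    have e : Real.cos (s / m) * (k + 2 * m ^ 2 * (1 - Real.cos (s / m))) -
        m * Real.sin (s / m) * (2 * m * Real.sin (s / m)) =
        k * Real.cos (s / m) - 2 * m ^ 2 * (1 - Real.cos (s / m)) := by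
      linear_combination -2 * m ^ 2 * Real.sin_sq_add_cos_sq (s / m)
    have hP : 0 ≤ 2 * m ^ 2 * (1 - Real.cos (s / m)) :=
      mul_nonneg (by positivity) (by linarith [Real.cos_le_one (s / m)])
    rw [e]
    refine (abs_sub _ _).trans ?_
    rw [abs_of_nonneg hP, abs_mul, add_comm]
    gcongr
    exact (mul_le_of_le_one_right (abs_nonneg _) (Real.abs_cos_le_one _)).trans (abs_le.2 hk)

lemma tendsto_cube_mul_div_sub_sin (s : ℝ) :
    Tendsto (fun m : ℝ => 2 * m ^ 3 * (s / m - Real.sin (s / m))) atTop (𝓝 (s ^ 3 / 3)) := by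
  have h0 : Tendsto (fun m : ℝ => 2 * (|s| ^ 5 / 100) / m) atTop (𝓝 0) :=
    tendsto_const_nhds.div_atTop tendsto_id
  rw [tendsto_iff_norm_sub_tendsto_zero]
  refine squeeze_zero' (Filter.Eventually.of_forall fun _ => norm_nonneg _) ?_ h0
  filter_upwards [eventually_ge_atTop (1 : ℝ), eventually_ge_atTop |s|] with m hm1 hms
  have hm : 0 < m := by linarith
  have habs : |s / m| = |s| / m := by rw [abs_div, abs_of_pos hm]
  have hb := Real.sin_bound (x := s / m) (by rw [habs]; exact (div_le_one hm).2 hms)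
  have e : 2 * m ^ 3 * (s / m - Real.sin (s / m)) - s ^ 3 / 3 =
      -(2 * m ^ 3 * (Real.sin (s / m) - (s / m - (s / m) ^ 3 / 6))) := by
    field_simp
    ring
  rw [Real.norm_eq_abs, e, abs_neg, abs_mul, abs_of_pos (by positivity : 0 < 2 * m ^ 3)]
  calc 2 * m ^ 3 * |Real.sin (s / m) - (s / m - (s / m) ^ 3 / 6)|
      ≤ 2 * m ^ 3 * (|s / m| ^ 5 / 100) := by gcongr
    _ = 2 * (|s| ^ 5 / 100) / m / m := by rw [habs]; field_simp
    _ ≤ 2 * (|s| ^ 5 / 100) / m := div_le_self (by positivity) hm1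

lemma tendsto_mul_sin_div (s : ℝ) :
    Tendsto (fun m : ℝ => m * Real.sin (s / m)) atTop (𝓝 s) := by
  have h1 : Tendsto (fun m : ℝ => 2 * m ^ 3 * (s / m - Real.sin (s / m)) / (2 * m ^ 2))
      atTop (𝓝 0) :=
    (tendsto_cube_mul_div_sub_sin s).div_atTop
      ((tendsto_pow_atTop two_ne_zero).const_mul_atTop two_pos)
  have h2 := h1.const_sub s
  rw [sub_zero] at h2
  refine h2.congr' ?_
  filter_upwards [eventually_gt_atTop (0 : ℝ)] with m hm
  field_simp
  ring

lemma tendsto_integral_besselJ_head {κ : ℝ} {m k : ℕ → ℝ} (hm : Tendsto m atTop atTop)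
    (hk : Tendsto k atTop (𝓝 κ)) (R : ℝ) :
    Tendsto (fun j => ∫ s in (0 : ℝ)..R, m j * Real.sin (s / m j) *
      Real.sin (k j * s + 2 * m j ^ 3 * (s / m j - Real.sin (s / m j)))) atTop
      (𝓝 (∫ s in (0 : ℝ)..R, s * Real.sin (s ^ 3 / 3 + κ * s))) := by
  refine intervalIntegral.tendsto_integral_filter_of_dominated_convergence (fun s => |s|) ?_ ?_
    (continuous_abs.intervalIntegrable _ _) ?_
  · exact Filter.Eventually.of_forall fun j => (by fun_prop : Continuous _).aestronglyMeasurable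
  · filter_upwards [hm.eventually_gt_atTop 0] with j hj
    refine Filter.Eventually.of_forall fun s _ => ?_
    rw [norm_mul, Real.norm_eq_abs, Real.norm_eq_abs]
    refine (mul_le_of_le_one_right (abs_nonneg _) (Real.abs_sin_le_one _)).trans ?_
    rw [abs_mul, abs_of_pos hj]
    calc m j * |Real.sin (s / m j)| ≤ m j * |s / m j| :=
          mul_le_mul_of_nonneg_left Real.abs_sin_le_abs hj.le
      _ = |s| := by rw [abs_div, abs_of_pos hj]; field_simp
  · refine Filter.Eventually.of_forall fun s _ => ?_
    refine ((tendsto_mul_sin_div s).comp hm).mul ?_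
    refine (Real.continuous_sin.tendsto _).comp ?_
    rw [add_comm (s ^ 3 / 3)]
    exact (hk.mul_const s).add ((tendsto_cube_mul_div_sub_sin s).comp hm)

/-- The rescaled Bessel integral converges to the improper integral representing `-π Ai'`. -/
lemma tendsto_integral_besselJ {κ L : ℝ} {m k : ℕ → ℝ} (hm : Tendsto m atTop atTop)
    (hk : Tendsto k atTop (𝓝 κ))
    (hL : Tendsto (fun R : ℝ => ∫ s in (0 : ℝ)..R, s * Real.sin (s ^ 3 / 3 + κ * s)) atTop (𝓝 L)) :
    Tendsto (fun j => ∫ s in (0 : ℝ)..π * m j, m j * Real.sin (s / m j) *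
      Real.sin (k j * s + 2 * m j ^ 3 * (s / m j - Real.sin (s / m j)))) atTop (𝓝 L) := by
  set K := |κ| + 1 with hKdef
  have hK : 1 ≤ K := by linarith [abs_nonneg κ]
  rw [Metric.tendsto_nhds]
  intro ε hε
  have hB : Tendsto (fun R : ℝ => 8 / R) atTop (𝓝 0) := tendsto_const_nhds.div_atTop tendsto_id
  obtain ⟨R, ⟨hR1, hR2⟩, hR3⟩ := ((hB.eventually_lt_const (by positivity : 0 < ε / 3)).and
    (eventually_ge_atTop (5 * K))).and
    (Metric.tendsto_nhds.1 hL (ε / 3) (by positivity)) |>.exists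
  filter_upwards [Metric.tendsto_nhds.1
    (tendsto_integral_besselJ_head hm hk R) (ε / 3) (by positivity),
    hm.eventually_gt_atTop 0, (hm.const_mul_atTop Real.pi_pos).eventually_ge_atTop R,
    hk.abs.eventually_le_const (by linarith : |κ| < K)] with j h1 hj hRj hkj
  have htail := abs_integral_besselJ_tail_le hK hkj hR2 hRj hj le_rfl
  rw [← intervalIntegral.integral_add_adjacent_intervals
    ((by fun_prop : Continuous _).intervalIntegrable 0 R)
    ((by fun_prop : Continuous _).intervalIntegrable R (π * m j))]
  rw [Real.dist_eq, abs_lt] at *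
  rw [abs_le] at htail
  constructor <;> linarith [h1.1, h1.2, hR3.1, hR3.2, htail.1, htail.2]

/-- Transition-region asymptotics of the derivative of the Bessel function near the quasi-front:
if `t_j → ∞` and `(n_j − t_j)/(t_j/2)^{1/3} → κ`, then `(t_j/2)^{2/3} J'_{n_j}(t_j) → −Ai'(κ)`. -/
theorem besselJ_deriv_airy_transition (κ : ℝ) (t : ℕ → ℝ) (n : ℕ → ℕ)
    (ht0 : ∀ j, 0 < t j) (ht : Tendsto t atTop atTop)
    (hn : Tendsto (fun j => ((n j : ℝ) - t j) / (t j / 2) ^ ((1 : ℝ) / 3)) atTop (𝓝 κ)) :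
    Tendsto (fun j => (t j / 2) ^ ((2 : ℝ) / 3) * deriv (besselJ (n j)) (t j)) atTop
      (𝓝 (-deriv airyAi κ)) := by
  obtain ⟨L, hAi, hL⟩ := airyAi_hasDerivAt κ
  have hm : Tendsto (fun j => (t j / 2) ^ ((1 : ℝ) / 3)) atTop atTop :=
    (tendsto_rpow_atTop (by norm_num)).comp (ht.atTop_div_const two_pos)
  rw [hAi.deriv, neg_neg]
  refine ((tendsto_integral_besselJ hm hn hL).const_mul (1 / π)).congr fun j => ?_
  have htj : 0 < t j / 2 := half_pos (ht0 j)
  set m := (t j / 2) ^ ((1 : ℝ) / 3) with hmdef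
  have hm0 : 0 < m := Real.rpow_pos_of_pos htj _
  have hm2 : (t j / 2) ^ ((2 : ℝ) / 3) = m ^ 2 := by
    rw [hmdef, ← Real.rpow_natCast, ← Real.rpow_mul htj.le]
    norm_num
  have hm3 : t j = 2 * m ^ 3 := by
    rw [hmdef, ← Real.rpow_natCast, ← Real.rpow_mul htj.le]
    norm_num
    ring
  have hsub := intervalIntegral.integral_comp_div (a := 0) (b := π * m)
    (fun θ => m * (Real.sin θ * Real.sin (n j * θ - t j * Real.sin θ))) hm0.ne'
  rw [zero_div, mul_div_cancel_right₀ _ hm0.ne', smul_eq_mul, intervalIntegral.integral_const_mul,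
    intervalIntegral.integral_const_mul] at hsub
  rw [hm2, deriv_besselJ]
  calc _ = 1 / π * (m * (m * ∫ θ in (0 : ℝ)..π,
        Real.sin θ * Real.sin (n j * θ - t j * Real.sin θ))) := by
        rw [← hsub]
        congr 1
        rw [← intervalIntegral.integral_const_mul]
        refine intervalIntegral.integral_congr fun s _ => ?_
        rw [mul_assoc]
        congr 3
        rw [← hm3]
        nth_rewrite 2 [hm3]
        field_simp
        rw [hm3]
        ring
    _ = _ := by ring
end

section
/- Fix κ ∈ ℝ. For all sequences (t_j) of positive reals with t_j → ∞ and all sequences (n_j) of natural numbers such that (n_j − t_j)/( (t_j/2)^{1/3} ) → κ, one has (t_j/2) · J''_{n_j}(t_j) → Ai''(κ) as j → ∞, where J''_n(x) denotes the second derivative of J_n with respect to x and Ai'' the second derivative of Ai. -/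
open Real Filter Topology

/-- First-derivative test (van der Corput) for an oscillatory integral with convex phase. -/
theorem abs_integral_cos_le_two_div {φ φ' φ'' : ℝ → ℝ} {a b : ℝ} (hab : a ≤ b)
    (hφ : ∀ x, HasDerivAt φ (φ' x) x) (hφ' : ∀ x, HasDerivAt φ' (φ'' x) x)
    (hconv : ∀ x ∈ Set.Icc a b, 0 ≤ φ'' x) (hpos : 0 < φ' a) :
    |∫ x in a..b, cos (φ x)| ≤ 2 / φ' a := by
  have hmono : MonotoneOn φ' (Set.Icc a b) := by
    refine monotoneOn_of_deriv_nonneg (convex_Icc a b)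
      (fun x _ => (hφ' x).continuousAt.continuousWithinAt)
      (fun x _ => (hφ' x).differentiableAt.differentiableWithinAt) fun x hx => ?_
    rw [(hφ' x).deriv]
    exact hconv x (interior_subset hx)
  have hpos' : ∀ x ∈ Set.Icc a b, 0 < φ' x := fun x hx =>
    hpos.trans_le (hmono (Set.left_mem_Icc.2 hab) hx hx.1)
  have hcos : Continuous fun x => cos (φ x) :=
    continuous_cos.comp (continuous_iff_continuousAt.2 fun x => (hφ x).continuousAt)
  have hder : ∀ c : ℝ, ∀ x ∈ Set.Icc a b, HasDerivAt (fun x => (sin (φ x) + c) / φ' x)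
      (cos (φ x) - (sin (φ x) + c) * φ'' x / φ' x ^ 2) x := by
    intro c x hx
    have hne := (hpos' x hx).ne'
    refine (((hφ x).sin.add_const c).div (hφ' x) hne).congr_deriv ?_
    field_simp
  have hint : MeasureTheory.IntegrableOn (fun x => cos (φ x)) (Set.Icc a b) :=
    hcos.continuousOn.integrableOn_Icc
  have hb := hpos' b (Set.right_mem_Icc.2 hab)
  rw [abs_le]
  constructor
  · have key := intervalIntegral.sub_le_integral_of_hasDeriv_right_of_le hab
      (fun x hx => (hder 1 x hx).continuousAt.continuousWithinAt)
      (fun x hx => (hder 1 x (Set.Ioo_subset_Icc_self hx)).hasDerivWithinAt) hint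
      (fun x hx => by
        have := hconv x (Set.Ioo_subset_Icc_self hx)
        have h1 : 0 ≤ sin (φ x) + 1 := by linarith [neg_one_le_sin (φ x)]
        have : 0 ≤ (sin (φ x) + 1) * φ'' x / φ' x ^ 2 := by positivity
        linarith)
    have h1 : 0 ≤ (sin (φ b) + 1) / φ' b :=
      div_nonneg (by linarith [neg_one_le_sin (φ b)]) hb.le
    have h2 : (sin (φ a) + 1) / φ' a ≤ 2 / φ' a :=
      div_le_div_of_nonneg_right (by linarith [sin_le_one (φ a)]) hpos.le
    linarith
  · have key := intervalIntegral.integral_le_sub_of_hasDeriv_right_of_le hab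
      (fun x hx => (hder (-1) x hx).continuousAt.continuousWithinAt)
      (fun x hx => (hder (-1) x (Set.Ioo_subset_Icc_self hx)).hasDerivWithinAt) hint
      (fun x hx => by
        have := hconv x (Set.Ioo_subset_Icc_self hx)
        have h1 : 0 ≤ -(sin (φ x) + -1) := by linarith [sin_le_one (φ x)]
        have : 0 ≤ -(sin (φ x) + -1) * φ'' x / φ' x ^ 2 := by positivity
        rw [neg_mul, neg_div] at this
        linarith)
    have h1 : (sin (φ b) + -1) / φ' b ≤ 0 :=
      div_nonpos_of_nonpos_of_nonneg (by linarith [sin_le_one (φ b)]) hb.le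
    have h2 : (-2) / φ' a ≤ (sin (φ a) + -1) / φ' a :=
      div_le_div_of_nonneg_right (by linarith [neg_one_le_sin (φ a)]) hpos.le
    rw [neg_div] at h2
    linarith

theorem hasDerivAt_integral_mul_cos {g α β : ℝ → ℝ} (hg : Continuous g) (hα : Continuous α)
    (hβ : Continuous β) (a b x : ℝ) :
    HasDerivAt (fun x => ∫ θ in a..b, g θ * cos (α θ + x * β θ))
      (∫ θ in a..b, -(g θ * β θ * sin (α θ + x * β θ))) x := by
  refine (intervalIntegral.hasDerivAt_integral_of_dominated_loc_of_deriv_le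
    (F := fun x θ => g θ * cos (α θ + x * β θ))
    (F' := fun x θ => -(g θ * β θ * sin (α θ + x * β θ)))
    (bound := fun θ => |g θ * β θ|) (s := Set.univ) Filter.univ_mem ?_ ?_ ?_ ?_ ?_ ?_).2
  · exact .of_forall fun y => (by fun_prop : Continuous _).aestronglyMeasurable
  · exact (by fun_prop : Continuous _).intervalIntegrable _ _
  · exact (by fun_prop : Continuous _).aestronglyMeasurable
  · refine .of_forall fun θ _ y _ => ?_
    rw [norm_neg, norm_mul, Real.norm_eq_abs, Real.norm_eq_abs]
    exact mul_le_of_le_one_right (abs_nonneg _) (abs_sin_le_one _)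
  · exact (by fun_prop : Continuous _).intervalIntegrable _ _
  · refine .of_forall fun θ _ y _ => ?_
    have h : HasDerivAt (fun y : ℝ => α θ + y * β θ) (β θ) y := by
      simpa using ((hasDerivAt_id y).mul_const (β θ)).const_add (α θ)
    exact (h.cos.const_mul (g θ)).congr_deriv (by ring)

theorem hasDerivAt_integral_mul_sin {g α β : ℝ → ℝ} (hg : Continuous g) (hα : Continuous α)
    (hβ : Continuous β) (a b x : ℝ) :
    HasDerivAt (fun x => ∫ θ in a..b, g θ * sin (α θ + x * β θ))
      (∫ θ in a..b, g θ * β θ * cos (α θ + x * β θ)) x := by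
  have h := hasDerivAt_integral_mul_cos (α := fun θ => α θ - π / 2) hg (by fun_prop) hβ a b x
  have e : ∀ y θ, α θ - π / 2 + y * β θ = α θ + y * β θ - π / 2 := fun y θ => by ring
  simpa only [e, cos_sub_pi_div_two, sin_sub_pi_div_two, mul_neg, neg_neg] using h

/-- The truncated Airy integral. -/
noncomputable def airyTrunc (R x : ℝ) : ℝ := ∫ t in (0 : ℝ)..R, cos (t ^ 3 / 3 + x * t)

theorem airyTrunc_sub_abs_le {x a b : ℝ} (ha : 0 ≤ a) (hab : a ≤ b) (hpos : 0 < a ^ 2 + x) :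
    |airyTrunc b x - airyTrunc a x| ≤ 2 / (a ^ 2 + x) := by
  rw [airyTrunc, airyTrunc, intervalIntegral.integral_interval_sub_left
    ((by fun_prop : Continuous _).intervalIntegrable _ _)
    ((by fun_prop : Continuous _).intervalIntegrable _ _)]
  refine abs_integral_cos_le_two_div (φ := fun t => t ^ 3 / 3 + x * t) (φ' := fun t => t ^ 2 + x)
    (φ'' := fun t => 2 * t) hab (fun t => ?_) (fun t => ?_) (fun t ht => ?_) hpos
  · exact (((hasDerivAt_pow 3 t).div_const 3).add ((hasDerivAt_id t).const_mul x)).congr_deriv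
      (by norm_num)
  · exact ((hasDerivAt_pow 2 t).add_const x).congr_deriv (by norm_num)
  · linarith [ht.1]

theorem tendsto_two_div_sq_mul_add (c x : ℝ) (hc : 0 < c) :
    Tendsto (fun R : ℝ => 2 / (c * R ^ 2 + x)) atTop (𝓝 0) :=
  tendsto_const_nhds.div_atTop
    (tendsto_atTop_add_const_right _ _ ((tendsto_pow_atTop two_ne_zero).const_mul_atTop hc))

theorem tendsto_airyTrunc (x : ℝ) :
    Tendsto (fun R => airyTrunc R x) atTop (𝓝 (π * airyAi x)) := by
  have h : ∃ l, Tendsto (fun R => airyTrunc R x) atTop (𝓝 l) := by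
    apply cauchySeq_tendsto_of_complete
    rw [Metric.cauchySeq_iff']
    intro ε hε
    have h1 := (tendsto_two_div_sq_mul_add 1 x one_pos).eventually_lt_const hε
    have h2 : ∀ᶠ R : ℝ in atTop, 0 < 1 * R ^ 2 + x :=
      (tendsto_atTop_add_const_right _ _
        ((tendsto_pow_atTop two_ne_zero).const_mul_atTop one_pos)).eventually_gt_atTop 0
    obtain ⟨N, h1, h2, h3⟩ := (h1.and (h2.and (eventually_ge_atTop 0))).exists
    rw [one_mul] at h1 h2
    exact ⟨N, fun R hR => (airyTrunc_sub_abs_le h3 hR h2).trans_lt h1⟩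
  have := tendsto_nhds_limUnder h
  rwa [airyAi, ← mul_assoc, mul_one_div_cancel pi_ne_zero, one_mul]

theorem abs_airyTrunc_le {M x R : ℝ} (hx : |x| ≤ M) (hR : 0 ≤ R) : |airyTrunc R x| ≤ M + 3 := by
  have hM : 0 ≤ M := (abs_nonneg x).trans hx
  have triv : ∀ S, 0 ≤ S → |airyTrunc S x| ≤ S := fun S hS => by
    have := intervalIntegral.norm_integral_le_of_norm_le_const (a := 0) (b := S) (C := 1)
      (f := fun t => cos (t ^ 3 / 3 + x * t)) (fun t _ => abs_cos_le_one _)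
    rwa [sub_zero, one_mul, abs_of_nonneg hS] at this
  rcases le_total R (M + 1) with h | h
  · linarith [triv R hR]
  · have h1 : 1 ≤ (M + 1) ^ 2 + x := by nlinarith [neg_abs_le x]
    have h2 := airyTrunc_sub_abs_le (by linarith) h (by linarith)
    have h3 : 2 / ((M + 1) ^ 2 + x) ≤ 2 := div_le_self (by norm_num) h1
    have h4 := triv (M + 1) (by linarith)
    have h5 := abs_add_le (airyTrunc R x - airyTrunc (M + 1) x) (airyTrunc (M + 1) x)
    rw [sub_add_cancel] at h5
    linarith

theorem hasDerivAt_airyTrunc (R x : ℝ) :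
    HasDerivAt (airyTrunc R) (∫ t in (0 : ℝ)..R, -(t * sin (t ^ 3 / 3 + x * t))) x := by
  have h := hasDerivAt_integral_mul_cos (g := fun _ => 1) (α := fun t => t ^ 3 / 3)
    (β := fun t => t) (by fun_prop) (by fun_prop) (by fun_prop) 0 R x
  simp only [one_mul] at h
  exact h

theorem continuous_airyTrunc (R : ℝ) : Continuous (airyTrunc R) :=
  continuous_iff_continuousAt.2 fun x => (hasDerivAt_airyTrunc R x).continuousAt

/-- The truncated Airy integral with its leading boundary term removed; it satisfies
the Airy-type identity that its second derivative in `x` is exactly `x * airyTrunc R x`. -/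
noncomputable def airyCorrected (R x : ℝ) : ℝ := airyTrunc R x - sin (R ^ 3 / 3 + x * R) / R ^ 2

/-- The derivative of `airyCorrected` in `x`. -/
noncomputable def airyCorrectedDeriv (R x : ℝ) : ℝ :=
  (∫ t in (0 : ℝ)..R, -(t * sin (t ^ 3 / 3 + x * t))) - cos (R ^ 3 / 3 + x * R) / R

theorem hasDerivAt_airyCorrected {R : ℝ} (hR : R ≠ 0) (x : ℝ) :
    HasDerivAt (airyCorrected R) (airyCorrectedDeriv R x) x := by
  have h : HasDerivAt (fun y : ℝ => R ^ 3 / 3 + y * R) R x := by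
    simpa using ((hasDerivAt_id x).mul_const R).const_add (R ^ 3 / 3)
  refine ((hasDerivAt_airyTrunc R x).sub (h.sin.div_const (R ^ 2))).congr_deriv ?_
  rw [airyCorrectedDeriv]
  congr 1
  field_simp

theorem hasDerivAt_airyCorrectedDeriv {R : ℝ} (hR : R ≠ 0) (x : ℝ) :
    HasDerivAt (airyCorrectedDeriv R) (x * airyTrunc R x) x := by
  have h : HasDerivAt (fun y : ℝ => R ^ 3 / 3 + y * R) R x := by
    simpa using ((hasDerivAt_id x).mul_const R).const_add (R ^ 3 / 3)
  have h1 := hasDerivAt_integral_mul_sin (g := fun t => -t) (α := fun t => t ^ 3 / 3)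
    (β := fun t => t) (by fun_prop) (by fun_prop) (by fun_prop) 0 R x
  have hbd : ∫ t in (0 : ℝ)..R, (t ^ 2 + x) * cos (t ^ 3 / 3 + x * t) =
      sin (R ^ 3 / 3 + x * R) := by
    rw [intervalIntegral.integral_eq_sub_of_hasDerivAt
      (f := fun t => sin (t ^ 3 / 3 + x * t)) (fun t _ => ?_)
      ((by fun_prop : Continuous _).intervalIntegrable _ _)]
    · simp
    · have : HasDerivAt (fun t : ℝ => t ^ 3 / 3 + x * t) (t ^ 2 + x) t :=
        (((hasDerivAt_pow 3 t).div_const 3).add ((hasDerivAt_id t).const_mul x)).congr_deriv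
          (by norm_num)
      exact this.sin.congr_deriv (by ring)
  simp only [neg_mul] at h1
  refine (h1.sub (h.cos.div_const R)).congr_deriv ?_
  rw [neg_mul, neg_div, mul_div_cancel_right₀ _ hR, sub_neg_eq_add, ← hbd, airyTrunc,
    ← intervalIntegral.integral_const_mul, ← intervalIntegral.integral_add
      ((by fun_prop : Continuous _).intervalIntegrable _ _)
      ((by fun_prop : Continuous _).intervalIntegrable _ _)]
  congr 1 with t
  ring

theorem tendsto_airyCorrected (x : ℝ) :
    Tendsto (fun R => airyCorrected R x) atTop (𝓝 (π * airyAi x)) := by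
  have h : Tendsto (fun R : ℝ => sin (R ^ 3 / 3 + x * R) / R ^ 2) atTop (𝓝 0) := by
    refine squeeze_zero_norm (a := fun R => 2 / (1 * R ^ 2 + 0)) (fun R => ?_)
      (tendsto_two_div_sq_mul_add 1 0 one_pos)
    rw [norm_div, norm_pow, Real.norm_eq_abs, Real.norm_eq_abs, sq_abs, one_mul, add_zero]
    exact div_le_div_of_nonneg_right ((abs_sin_le_one _).trans one_le_two) (sq_nonneg R)
  simpa [airyCorrected] using (tendsto_airyTrunc x).sub h

theorem airyCorrectedDeriv_eq {R : ℝ} (hR : R ≠ 0) (x : ℝ) :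
    airyCorrectedDeriv R x = airyCorrectedDeriv R 0 + ∫ z in (0 : ℝ)..x, z * airyTrunc R z := by
  rw [intervalIntegral.integral_eq_sub_of_hasDerivAt
    (fun z _ => hasDerivAt_airyCorrectedDeriv hR z)
    ((continuous_id.mul (continuous_airyTrunc R)).intervalIntegrable _ _)]
  ring

theorem airyCorrected_eq {R : ℝ} (hR : R ≠ 0) (x : ℝ) :
    airyCorrected R x = airyCorrected R 0 + airyCorrectedDeriv R 0 * x +
      ∫ y in (0 : ℝ)..x, ∫ z in (0 : ℝ)..y, z * airyTrunc R z := by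
  have hc : Continuous (airyCorrectedDeriv R) :=
    continuous_iff_continuousAt.2 fun x => (hasDerivAt_airyCorrectedDeriv hR x).continuousAt
  have h := intervalIntegral.integral_eq_sub_of_hasDerivAt (a := 0) (b := x)
    (fun z _ => hasDerivAt_airyCorrected hR z) (hc.intervalIntegrable _ _)
  have hK : ∀ y, ∫ z in (0 : ℝ)..y, z * airyTrunc R z =
      airyCorrectedDeriv R y - airyCorrectedDeriv R 0 := fun y => by
    rw [airyCorrectedDeriv_eq hR y]; ring
  simp only [hK]
  rw [intervalIntegral.integral_sub (hc.intervalIntegrable _ _) (by simp), h]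
  simp
  ring

theorem measurable_airyAi : Measurable airyAi := by
  have h : Measurable fun x => π * airyAi x :=
    measurable_of_tendsto_metrizable' atTop (fun R => (continuous_airyTrunc R).measurable)
      (tendsto_pi_nhds.2 tendsto_airyTrunc)
  have h2 := h.const_mul π⁻¹
  simpa [← mul_assoc, pi_ne_zero] using h2

theorem abs_pi_mul_airyAi_le {M x : ℝ} (hx : |x| ≤ M) : |π * airyAi x| ≤ M + 3 :=
  le_of_tendsto (tendsto_airyTrunc x).abs
    ((eventually_ge_atTop 0).mono fun _ hR => abs_airyTrunc_le hx hR)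

theorem abs_le_abs_of_mem_uIoc {x z : ℝ} (hz : z ∈ Set.uIoc 0 x) : |z| ≤ |x| := by
  simpa using Set.abs_sub_left_of_mem_uIcc (Set.uIoc_subset_uIcc hz)

theorem tendsto_integral_mul_airyTrunc (y : ℝ) :
    Tendsto (fun R => ∫ z in (0 : ℝ)..y, z * airyTrunc R z) atTop
      (𝓝 (∫ z in (0 : ℝ)..y, z * (π * airyAi z))) := by
  refine intervalIntegral.tendsto_integral_filter_of_dominated_convergence
    (fun _ => |y| * (|y| + 3)) ?_ ?_ (by simp) ?_
  · exact .of_forall fun R => (continuous_id.mul (continuous_airyTrunc R)).aestronglyMeasurable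
  · filter_upwards [eventually_ge_atTop 0] with R hR
    refine .of_forall fun z hz => ?_
    have h := abs_le_abs_of_mem_uIoc hz
    rw [norm_mul]
    exact mul_le_mul h (abs_airyTrunc_le h hR) (abs_nonneg _) (abs_nonneg _)
  · exact .of_forall fun z _ => (tendsto_airyTrunc z).const_mul z

theorem intervalIntegrable_mul_airyAi (a b : ℝ) :
    IntervalIntegrable (fun z => z * (π * airyAi z)) MeasureTheory.volume a b := by
  have h0 : ∀ y, IntervalIntegrable (fun z => z * (π * airyAi z)) MeasureTheory.volume 0 y := by
    intro y
    refine (intervalIntegrable_const (c := |y| * (|y| + 3))).mono_fun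
      (measurable_id.mul (measurable_airyAi.const_mul π)).aestronglyMeasurable ?_
    refine (MeasureTheory.ae_restrict_iff' measurableSet_uIoc).2 (.of_forall fun z hz => ?_)
    have h := abs_le_abs_of_mem_uIoc hz
    have h3 : 0 ≤ |y| * (|y| + 3) := by positivity
    beta_reduce
    rw [Real.norm_of_nonneg h3, norm_mul]
    exact mul_le_mul h (abs_pi_mul_airyAi_le h) (abs_nonneg _) (abs_nonneg _)
  exact (h0 a).symm.trans (h0 b)

theorem tendsto_integral_integral_mul_airyTrunc (x : ℝ) :
    Tendsto (fun R => ∫ y in (0 : ℝ)..x, ∫ z in (0 : ℝ)..y, z * airyTrunc R z) atTop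
      (𝓝 (∫ y in (0 : ℝ)..x, ∫ z in (0 : ℝ)..y, z * (π * airyAi z))) := by
  refine intervalIntegral.tendsto_integral_filter_of_dominated_convergence
    (fun _ => |x| * (|x| + 3) * |x|) ?_ ?_ (by simp) ?_
  · exact .of_forall fun R => (intervalIntegral.continuous_primitive (fun a b =>
      (continuous_id.mul (continuous_airyTrunc R)).intervalIntegrable a b) 0).aestronglyMeasurable
  · filter_upwards [eventually_ge_atTop 0] with R hR
    refine .of_forall fun y hy => ?_
    have hyx := abs_le_abs_of_mem_uIoc hy
    refine (intervalIntegral.norm_integral_le_of_norm_le_const (C := |x| * (|x| + 3))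
      fun z hz => ?_).trans ?_
    · have h := (abs_le_abs_of_mem_uIoc hz).trans hyx
      rw [norm_mul]
      exact mul_le_mul h (abs_airyTrunc_le h hR) (abs_nonneg _) (abs_nonneg _)
    · rw [sub_zero]
      gcongr
  · exact .of_forall fun y _ => tendsto_integral_mul_airyTrunc y

theorem exists_airyAi_eq : ∃ a b : ℝ, ∀ x, π * airyAi x = a + b * x +
    ∫ y in (0 : ℝ)..x, ∫ z in (0 : ℝ)..y, z * (π * airyAi z) := by
  have hlim : ∀ x, Tendsto (fun R => airyCorrectedDeriv R 0 * x) atTop (𝓝 (π * airyAi x -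
      π * airyAi 0 - ∫ y in (0 : ℝ)..x, ∫ z in (0 : ℝ)..y, z * (π * airyAi z))) := fun x => by
    refine (((tendsto_airyCorrected x).sub (tendsto_airyCorrected 0)).sub
      (tendsto_integral_integral_mul_airyTrunc x)).congr' ?_
    filter_upwards [eventually_ne_atTop 0] with R hR
    rw [airyCorrected_eq hR x]
    ring
  have h1 := hlim 1
  simp only [mul_one] at h1
  refine ⟨π * airyAi 0, π * airyAi 1 - π * airyAi 0 -
    ∫ y in (0 : ℝ)..1, ∫ z in (0 : ℝ)..y, z * (π * airyAi z), fun x => ?_⟩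
  rw [← tendsto_nhds_unique (hlim x) (h1.mul_const x)]
  ring

/-- Airy's equation `Ai'' = x Ai`. -/
theorem iteratedDeriv_two_airyAi (x : ℝ) : iteratedDeriv 2 airyAi x = x * airyAi x := by
  obtain ⟨a, b, h⟩ := exists_airyAi_eq
  have hK : Continuous fun y => ∫ z in (0 : ℝ)..y, z * (π * airyAi z) :=
    intervalIntegral.continuous_primitive intervalIntegrable_mul_airyAi 0
  have hAi : airyAi = fun x => π⁻¹ * (a + b * x +
      ∫ y in (0 : ℝ)..x, ∫ z in (0 : ℝ)..y, z * (π * airyAi z)) := by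
    ext x
    rw [← h, inv_mul_cancel_left₀ pi_ne_zero]
  have hd : ∀ x, HasDerivAt airyAi (π⁻¹ * (b + ∫ z in (0 : ℝ)..x, z * (π * airyAi z))) x := by
    intro x
    have hd' := ((((hasDerivAt_id x).const_mul b).const_add a).add
      (hK.integral_hasStrictDerivAt 0 x).hasDerivAt).const_mul π⁻¹
    rw [mul_one] at hd'
    exact hd'.congr_of_eventuallyEq (.of_forall (congrFun hAi))
  have hc : Continuous airyAi := continuous_iff_continuousAt.2 fun x => (hd x).continuousAt
  have hc' : Continuous fun z => z * (π * airyAi z) := by fun_prop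
  rw [iteratedDeriv_succ, iteratedDeriv_one, funext fun x => (hd x).deriv]
  refine HasDerivAt.deriv ((((hc'.integral_hasStrictDerivAt 0 x).hasDerivAt.const_add
    b).const_mul π⁻¹).congr_deriv ?_)
  field_simp

theorem abs_integral_cos_transition_le {k m R : ℝ} (hm : 0 < m) (hR : 0 ≤ R) (hRm : R ≤ m * π)
    (hpos : 0 < 4 / π ^ 2 * R ^ 2 + k) :
    |∫ s in R..m * π, cos (k * s + 2 * m ^ 3 * (s / m - sin (s / m)))| ≤
      2 / (4 / π ^ 2 * R ^ 2 + k) := by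
  have hle : 4 / π ^ 2 * R ^ 2 + k ≤ k + 2 * m ^ 2 * (1 - cos (R / m)) := by
    have hu : |R / m| ≤ π := by
      rw [abs_of_nonneg (by positivity), div_le_iff₀ hm]
      linarith
    have h1 : 2 / π ^ 2 * (R / m) ^ 2 ≤ 1 - cos (R / m) := by
      linarith [cos_le_one_sub_mul_cos_sq hu]
    have h2 := mul_le_mul_of_nonneg_left h1 (by positivity : 0 ≤ 2 * m ^ 2)
    have h3 : 2 * m ^ 2 * (2 / π ^ 2 * (R / m) ^ 2) = 4 / π ^ 2 * R ^ 2 := by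
      field_simp
      ring
    linarith
  refine (abs_integral_cos_le_two_div (φ' := fun s => k + 2 * m ^ 2 * (1 - cos (s / m)))
    (φ'' := fun s => 2 * m * sin (s / m)) hRm (fun s => ?_) (fun s => ?_) (fun s hs => ?_)
    (hpos.trans_le hle)).trans (div_le_div_of_nonneg_left zero_le_two hpos hle)
  · have h := (hasDerivAt_id s).div_const m
    refine (((hasDerivAt_id s).const_mul k).add
      ((h.sub h.sin).const_mul (2 * m ^ 3))).congr_deriv ?_
    simp only [id]
    field_simp
  · have h := (hasDerivAt_id s).div_const m
    refine (((h.cos.const_sub 1).const_mul (2 * m ^ 2)).const_add k).congr_deriv ?_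
    simp only [id]
    field_simp
  · have h1 : 0 ≤ s / m := div_nonneg (hR.trans hs.1) hm.le
    have h2 : s / m ≤ π := by
      rw [div_le_iff₀ hm]
      linarith [hs.2]
    have := sin_nonneg_of_nonneg_of_le_pi h1 h2
    positivity

theorem tendsto_cube_mul_sub_sin {m : ℕ → ℝ} (hm : Tendsto m atTop atTop) (s : ℝ) :
    Tendsto (fun j => 2 * m j ^ 3 * (s / m j - sin (s / m j))) atTop (𝓝 (s ^ 3 / 3)) := by
  rw [tendsto_iff_norm_sub_tendsto_zero]
  refine squeeze_zero' (.of_forall fun _ => norm_nonneg _) (g := fun j => s ^ 4 / m j) ?_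
    (tendsto_const_nhds.div_atTop hm)
  filter_upwards [hm.eventually_gt_atTop 0, hm.eventually_ge_atTop |s|] with j h0 h1
  have hu : |s / m j| ≤ 1 := by
    rw [abs_div, abs_of_pos h0, div_le_one h0]
    exact h1
  have h2 := sin_bound hu
  have e : 2 * m j ^ 3 * (s / m j - sin (s / m j)) - s ^ 3 / 3 =
      -(2 * m j ^ 3 * (sin (s / m j) - (s / m j - (s / m j) ^ 3 / 6))) := by
    field_simp
    ring
  rw [e, norm_neg, Real.norm_eq_abs, abs_mul, abs_of_pos (by positivity : 0 < 2 * m j ^ 3)]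
  calc 2 * m j ^ 3 * |sin (s / m j) - (s / m j - (s / m j) ^ 3 / 6)|
      ≤ 2 * m j ^ 3 * (|s / m j| ^ 5 / 100) := by gcongr
    _ ≤ 2 * m j ^ 3 * (|s / m j| ^ 4 / 100) := by
      have := pow_le_pow_of_le_one (abs_nonneg _) hu (by norm_num : 4 ≤ 5)
      gcongr
    _ = s ^ 4 / m j * (1 / 50) := by
      rw [Even.pow_abs (by decide)]
      field_simp
      ring
    _ ≤ s ^ 4 / m j := mul_le_of_le_one_right (by positivity) (by norm_num)

theorem tendsto_integral_cos_transition {k m : ℕ → ℝ} {κ : ℝ} (hk : Tendsto k atTop (𝓝 κ))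
    (hm : Tendsto m atTop atTop) :
    Tendsto (fun j => ∫ s in (0 : ℝ)..m j * π,
      cos (k j * s + 2 * m j ^ 3 * (s / m j - sin (s / m j)))) atTop (𝓝 (π * airyAi κ)) := by
  rw [Metric.tendsto_atTop']
  intro ε hε
  have hc : 0 < 4 / π ^ 2 := by positivity
  have hpos : ∀ᶠ R : ℝ in atTop, 0 < 4 / π ^ 2 * R ^ 2 + (κ - 1) :=
    (tendsto_atTop_add_const_right _ _
      ((tendsto_pow_atTop two_ne_zero).const_mul_atTop hc)).eventually_gt_atTop 0
  have htail := (tendsto_two_div_sq_mul_add _ (κ - 1) hc).eventually_lt_const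
    (by positivity : 0 < ε / 3)
  have hairy := Metric.tendsto_nhds.1 (tendsto_airyTrunc κ) (ε / 3) (by positivity)
  obtain ⟨R, hR0, hpos, htail, hairy⟩ :=
    ((eventually_ge_atTop 0).and (hpos.and (htail.and hairy))).exists
  have hmain : Tendsto (fun j => ∫ s in (0 : ℝ)..R,
      cos (k j * s + 2 * m j ^ 3 * (s / m j - sin (s / m j)))) atTop (𝓝 (airyTrunc R κ)) := by
    refine intervalIntegral.tendsto_integral_filter_of_dominated_convergence (fun _ => 1) ?_ ?_
      (by simp) ?_
    · exact .of_forall fun j => (by fun_prop : Continuous _).aestronglyMeasurable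
    · exact .of_forall fun j => .of_forall fun s _ => abs_cos_le_one _
    · refine .of_forall fun s _ => (continuous_cos.tendsto _).comp ?_
      rw [add_comm (s ^ 3 / 3)]
      exact (hk.mul_const s).add (tendsto_cube_mul_sub_sin hm s)
  have h := (Metric.tendsto_nhds.1 hmain (ε / 3) (by positivity)).and
    ((hk.eventually_const_lt (sub_one_lt κ)).and
      ((hm.eventually_gt_atTop 0).and (hm.eventually_ge_atTop (R / π))))
  obtain ⟨N, hN⟩ := eventually_atTop.1 h
  refine ⟨N, fun j hj => ?_⟩
  obtain ⟨h1, h2, h3, h4⟩ := hN j hj.le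
  have hle : 4 / π ^ 2 * R ^ 2 + (κ - 1) ≤ 4 / π ^ 2 * R ^ 2 + k j := by linarith
  have h5 := (abs_integral_cos_transition_le h3 hR0 ((div_le_iff₀ pi_pos).1 h4)
    (hpos.trans_le hle)).trans (div_le_div_of_nonneg_left zero_le_two hpos hle)
  rw [← intervalIntegral.integral_add_adjacent_intervals (b := R)
    ((by fun_prop : Continuous _).intervalIntegrable _ _)
    ((by fun_prop : Continuous _).intervalIntegrable _ _)]
  rw [Real.dist_eq, abs_lt] at *
  rw [abs_le] at h5
  constructor <;> linarith [h1.1, h1.2, h5.1, h5.2, hairy.1, hairy.2]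

/-- The Bessel integral without its normalisation, for real order. -/
noncomputable def besselIntegral (ν x : ℝ) : ℝ := ∫ θ in (0 : ℝ)..π, cos (ν * θ - x * sin θ)

theorem mul_besselIntegral_eq {ν x m : ℝ} (hm : m ≠ 0) (hx : x = 2 * m ^ 3) :
    m * besselIntegral ν x = ∫ s in (0 : ℝ)..m * π,
      cos ((ν - x) / m * s + 2 * m ^ 3 * (s / m - sin (s / m))) := by
  have h := intervalIntegral.integral_comp_div (a := 0) (b := m * π)
    (fun θ => cos (ν * θ - x * sin θ)) hm
  rw [zero_div, mul_div_cancel_left₀ _ hm, smul_eq_mul] at h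
  rw [besselIntegral, ← h]
  congr 1 with s
  congr 1
  rw [← hx]
  ring

theorem tendsto_mul_besselIntegral {ν x m : ℕ → ℝ} {κ : ℝ} (hm : Tendsto m atTop atTop)
    (hx : ∀ j, x j = 2 * m j ^ 3) (hν : Tendsto (fun j => (ν j - x j) / m j) atTop (𝓝 κ)) :
    Tendsto (fun j => m j * besselIntegral (ν j) (x j)) atTop (𝓝 (π * airyAi κ)) := by
  refine (tendsto_integral_cos_transition hν hm).congr' ?_
  filter_upwards [hm.eventually_ne_atTop 0] with j hj
  exact (mul_besselIntegral_eq hj (hx j)).symm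

theorem hasDerivAt_besselIntegral (ν x : ℝ) :
    HasDerivAt (besselIntegral ν) (∫ θ in (0 : ℝ)..π, sin θ * sin (ν * θ - x * sin θ)) x := by
  have h := hasDerivAt_integral_mul_cos (g := fun _ => 1) (α := fun θ => ν * θ)
    (β := fun θ => -sin θ) (by fun_prop) (by fun_prop) (by fun_prop) 0 π x
  simp only [one_mul, mul_neg, neg_mul, neg_neg, ← sub_eq_add_neg] at h
  exact h

theorem hasDerivAt_integral_sin_mul_sin (ν x : ℝ) :
    HasDerivAt (fun x => ∫ θ in (0 : ℝ)..π, sin θ * sin (ν * θ - x * sin θ))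
      (∫ θ in (0 : ℝ)..π, -(sin θ ^ 2 * cos (ν * θ - x * sin θ))) x := by
  have h := hasDerivAt_integral_mul_sin (g := fun θ => sin θ) (α := fun θ => ν * θ)
    (β := fun θ => -sin θ) (by fun_prop) (by fun_prop) (by fun_prop) 0 π x
  simp only [mul_neg, neg_mul, ← sub_eq_add_neg, ← sq] at h
  exact h

theorem integral_sin_mul_sin_eq (ν x : ℝ) :
    ∫ θ in (0 : ℝ)..π, sin θ * sin (ν * θ - x * sin θ) =
      (besselIntegral (ν - 1) x - besselIntegral (ν + 1) x) / 2 := by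
  rw [besselIntegral, besselIntegral, ← intervalIntegral.integral_sub
    ((by fun_prop : Continuous _).intervalIntegrable _ _)
    ((by fun_prop : Continuous _).intervalIntegrable _ _), ← intervalIntegral.integral_div]
  congr 1 with θ
  rw [show (ν - 1) * θ - x * sin θ = (ν * θ - x * sin θ) - θ by ring,
    show (ν + 1) * θ - x * sin θ = (ν * θ - x * sin θ) + θ by ring, cos_sub, cos_add]
  ring

/-- Bessel's equation, for the integral representation. -/
theorem besselIntegral_ode (n : ℕ) (x : ℝ) :
    x ^ 2 * (∫ θ in (0 : ℝ)..π, -(sin θ ^ 2 * cos (n * θ - x * sin θ))) =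
      (n ^ 2 - x ^ 2) * besselIntegral n x -
        x * ∫ θ in (0 : ℝ)..π, sin θ * sin (n * θ - x * sin θ) := by
  have h0 := intervalIntegral.integral_eq_sub_of_hasDerivAt (a := 0) (b := π)
    (f := fun θ => (n + x * cos θ) * sin (n * θ - x * sin θ))
    (f' := fun θ => (n ^ 2 - x ^ 2) * cos (n * θ - x * sin θ) -
      x * (sin θ * sin (n * θ - x * sin θ)) -
      x ^ 2 * -(sin θ ^ 2 * cos (n * θ - x * sin θ)))
    (fun θ _ => by
      have h1 : HasDerivAt (fun θ : ℝ => n * θ - x * sin θ) (n - x * cos θ) θ := by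
        exact (((hasDerivAt_id θ).const_mul (n : ℝ)).sub
          ((hasDerivAt_sin θ).const_mul x)).congr_deriv (by rw [mul_one])
      have h2 : HasDerivAt (fun θ : ℝ => n + x * cos θ) (x * -sin θ) θ :=
        ((hasDerivAt_cos θ).const_mul x).const_add _
      refine (h2.mul h1.sin).congr_deriv ?_
      linear_combination (-x ^ 2 * cos (n * θ - x * sin θ)) * sin_sq_add_cos_sq θ)
    ((by fun_prop : Continuous _).intervalIntegrable _ _)
  rw [intervalIntegral.integral_sub ((by fun_prop : Continuous _).intervalIntegrable _ _)
      ((by fun_prop : Continuous _).intervalIntegrable _ _),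
    intervalIntegral.integral_sub ((by fun_prop : Continuous _).intervalIntegrable _ _)
      ((by fun_prop : Continuous _).intervalIntegrable _ _),
    intervalIntegral.integral_const_mul, intervalIntegral.integral_const_mul,
    intervalIntegral.integral_const_mul] at h0
  simp only [sin_pi, sin_zero, mul_zero, sub_zero, sin_nat_mul_pi] at h0
  rw [besselIntegral]
  linarith

theorem iteratedDeriv_two_besselJ (n : ℕ) {x : ℝ} (hx : x ≠ 0) :
    iteratedDeriv 2 (besselJ n) x = 1 / π * ((n ^ 2 - x ^ 2) / x ^ 2 * besselIntegral n x -
      (besselIntegral (n - 1) x - besselIntegral (n + 1) x) / (2 * x)) := by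
  have h1 : deriv (besselJ n) = fun x =>
      1 / π * ∫ θ in (0 : ℝ)..π, sin θ * sin (n * θ - x * sin θ) :=
    funext fun x => ((hasDerivAt_besselIntegral n x).const_mul (1 / π)).deriv
  rw [iteratedDeriv_succ, iteratedDeriv_one, h1,
    ((hasDerivAt_integral_sin_mul_sin n x).const_mul (1 / π)).deriv]
  congr 1
  have h := besselIntegral_ode n x
  rw [integral_sin_mul_sin_eq] at h
  generalize (∫ θ in (0 : ℝ)..π, -(sin θ ^ 2 * cos (n * θ - x * sin θ))) = I at h ⊢
  field_simp
  linear_combination 2 * h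

/-- Transition-region asymptotics of the second derivative of the Bessel function near the
quasi-front: if `t_j → ∞` and `(n_j − t_j)/(t_j/2)^{1/3} → κ`, then
`(t_j/2) J''_{n_j}(t_j) → Ai''(κ)`. -/
theorem besselJ_second_deriv_airy_transition (κ : ℝ) (t : ℕ → ℝ) (n : ℕ → ℕ)
    (ht0 : ∀ j, 0 < t j) (ht : Tendsto t atTop atTop)
    (hn : Tendsto (fun j => ((n j : ℝ) - t j) / (t j / 2) ^ ((1 : ℝ) / 3)) atTop (𝓝 κ)) :
    Tendsto (fun j => (t j / 2) * iteratedDeriv 2 (besselJ (n j)) (t j)) atTop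
      (𝓝 (iteratedDeriv 2 airyAi κ)) := by
  set m : ℕ → ℝ := fun j => (t j / 2) ^ ((1 : ℝ) / 3) with hm_def
  have hm : Tendsto m atTop atTop :=
    (tendsto_rpow_atTop (by norm_num)).comp (ht.atTop_div_const two_pos)
  have hmpos : ∀ j, 0 < m j := fun j => rpow_pos_of_pos (half_pos (ht0 j)) _
  have htm : ∀ j, t j = 2 * m j ^ 3 := fun j => by
    rw [hm_def, ← rpow_natCast, ← rpow_mul (half_pos (ht0 j)).le]
    norm_num
    ring
  have hn' : Tendsto (fun j => ((n j : ℝ) - t j) / m j) atTop (𝓝 κ) := hn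
  clear_value m
  have hinv : Tendsto (fun j => 1 / m j) atTop (𝓝 0) := tendsto_const_nhds.div_atTop hm
  have h0 := tendsto_mul_besselIntegral hm htm hn'
  have hpred := tendsto_mul_besselIntegral (ν := fun j => (n j : ℝ) - 1) (κ := κ) hm htm (by
    simpa using (hn'.sub hinv).congr fun j => by ring)
  have hsucc := tendsto_mul_besselIntegral (ν := fun j => (n j : ℝ) + 1) (κ := κ) hm htm (by
    simpa using (hn'.add hinv).congr fun j => by ring)
  rw [iteratedDeriv_two_airyAi]
  have hfac : Tendsto (fun j => 1 + ((n j : ℝ) - t j) / m j * (1 / m j) ^ 2 / 4) atTop (𝓝 1) := by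
    simpa using ((hn'.mul (hinv.pow 2)).div_const 4).const_add 1
  have hlim := (((hn'.mul hfac).mul h0).sub (((hpred.sub hsucc).mul hinv).div_const 4)).const_mul
    (1 / π)
  have hval : 1 / π * (κ * 1 * (π * airyAi κ) - (π * airyAi κ - π * airyAi κ) * 0 / 4) =
      κ * airyAi κ := by
    field_simp
    ring
  rw [hval] at hlim
  refine hlim.congr fun j => ?_
  rw [iteratedDeriv_two_besselJ (n j) (ht0 j).ne', htm j]
  have := (hmpos j).ne'
  field_simp
  ring
end
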